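/- arXiv:2012.14551 — 2 statements merged into one kernel-verified Lean document; each statement's English description precedes it below -/
import Mathlib

section
/- Let G be a connected graph of order n with diameter diam(G). Then h_p(G) ≤ max{1, n − diam(G) − 1}. -/
open SimpleGraph

namespace Paper

/-- A graph is traceable if it has a hamiltonian path. -/
def Traceable {α : Type*} (G : SimpleGraph α) : Prop :=
  ∃ (a b : α) (p : G.Walk a b), p.IsPath ∧ ∀ w, w ∈ p.support

/-- A graph is hamiltonian if it has a hamiltonian cycle. -/
def HamGraph {α : Type*} (G : SimpleGraph α) : Prop :=
  ∃ (a : α) (p : G.Walk a a), p.IsCycle ∧ ∀ w, w ∈ p.support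

/-- A graph together with its (varying) vertex type. -/
def GraphSys : Type 1 := Σ V : Type, SimpleGraph V

/-- One application of the line-graph operator. -/
def lineStep (p : GraphSys) : GraphSys := ⟨p.2.edgeSet, p.2.lineGraph⟩

/-- The `n`-th iterated line graph (with `L^0(G) = G`). -/
def iterLine (p : GraphSys) (n : ℕ) : GraphSys := lineStep^[n] p

/-- The hamiltonian path index: the least `n` with `L^n(G)` traceable. -/
noncomputable def hp {V : Type} (G : SimpleGraph V) : ℕ :=
  sInf {n | Traceable (iterLine ⟨V, G⟩ n).2}

/-- The hamiltonian index: the least `n` with `L^n(G)` hamiltonian. -/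
noncomputable def hIndex {V : Type} (G : SimpleGraph V) : ℕ :=
  sInf {n | HamGraph (iterLine ⟨V, G⟩ n).2}

/-- Degree of `v` in a subgraph `H` (number of neighbours). -/
noncomputable def sdeg {V : Type*} {G : SimpleGraph V} (H : G.Subgraph) (v : V) : ℕ :=
  (H.neighborSet v).ncard

/-- Degree of `v` in `G` (number of neighbours). -/
noncomputable def gdeg {V : Type*} (G : SimpleGraph V) (v : V) : ℕ :=
  (G.neighborSet v).ncard

/-- `Ē(H)`: the set of edges of `G` incident with a vertex of `H`. -/
def barE {V : Type*} (G : SimpleGraph V) (H : G.Subgraph) : Set (Sym2 V) :=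
  {e | e ∈ G.edgeSet ∧ ∃ v ∈ H.verts, v ∈ e}

/-- A circuit: a connected subgraph in which every vertex has even degree
(`K₁` counts as a circuit). -/
def IsCircuit {V : Type*} {G : SimpleGraph V} (H : G.Subgraph) : Prop :=
  H.Connected ∧ ∀ v, Even (sdeg H v)

/-- A branch of `G`: a nontrivial path whose ends have degree `≠ 2` and whose
internal vertices have degree `2`. -/
def IsBranch {V : Type*} (G : SimpleGraph V) {u v : V} (p : G.Walk u v) : Prop :=
  p.IsPath ∧ 0 < p.length ∧ gdeg G u ≠ 2 ∧ gdeg G v ≠ 2 ∧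
    ∀ w ∈ p.support, w ≠ u → w ≠ v → gdeg G w = 2

/-- The family `EUP_k(G)` of subgraphs satisfying (I'), (II), (III), (IV), (V'). -/
def EUP {V : Type*} (G : SimpleGraph V) (k : ℕ) : Set (G.Subgraph) :=
  {H | {v | Odd (sdeg H v)}.ncard ≤ 2 ∧
    (∀ v ∈ H.verts, H.neighborSet v = ∅ → 3 ≤ gdeg G v) ∧
    (∀ v, 3 ≤ gdeg G v → v ∈ H.verts) ∧
    (∀ H1 : G.Subgraph, H1 ≤ H → H1.verts.Nonempty → (H.verts \ H1.verts).Nonempty →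
      ∃ a ∈ H1.verts, ∃ b ∈ H.verts \ H1.verts, G.dist a b ≤ k - 1) ∧
    (∀ (u v : V) (p : G.Walk u v), IsBranch G p →
      (∀ e ∈ p.edges, e ∉ H.edgeSet) → p.length ≤ k + 1) ∧
    (∀ (u v : V) (p : G.Walk u v), IsBranch G p → (∃ w ∈ p.support, gdeg G w = 1) →
      (∀ e ∈ p.edges, e ∉ H.edgeSet) → p.length ≤ k)}

/-- The family `EU_k(G)` of subgraphs satisfying (I), (II), (III), (IV), (V). -/
def EU {V : Type*} (G : SimpleGraph V) (k : ℕ) : Set (G.Subgraph) :=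
  {H | (∀ v, Even (sdeg H v)) ∧
    (∀ v ∈ H.verts, H.neighborSet v = ∅ → 3 ≤ gdeg G v) ∧
    (∀ v, 3 ≤ gdeg G v → v ∈ H.verts) ∧
    (∀ H1 : G.Subgraph, H1 ≤ H → H1.verts.Nonempty → (H.verts \ H1.verts).Nonempty →
      ∃ a ∈ H1.verts, ∃ b ∈ H.verts \ H1.verts, G.dist a b ≤ k - 1) ∧
    (∀ (u v : V) (p : G.Walk u v), IsBranch G p →
      (∀ e ∈ p.edges, e ∉ H.edgeSet) → p.length ≤ k + 1) ∧
    (∀ (u v : V) (p : G.Walk u v), IsBranch G p → (∃ w ∈ p.support, gdeg G w = 1) →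
      p.length ≤ k)}


/-! ### Parity of degrees -/

/-- `v` has odd degree in `G`. -/
def Od {V : Type*} (G : SimpleGraph V) (v : V) : Prop := Odd (G.neighborSet v).ncard

theorem od_flip {V : Type*} [Finite V] {G G' : SimpleGraph V} {u v : V} (huv : u ≠ v)
    (h0 : ¬ G.Adj u v) (h : ∀ a b, G'.Adj a b ↔ G.Adj a b ∨ s(a, b) = s(u, v)) (x : V) :
    Od G' x ↔ (Od G x ↔ ¬ (x = u ∨ x = v)) := by
  unfold Od
  by_cases hxu : x = u
  · subst hxu
    have : G'.neighborSet x = insert v (G.neighborSet x) := by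
      ext y
      simp only [mem_neighborSet, h, Set.mem_insert_iff, Sym2.eq_iff]
      grind
    rw [this, Set.ncard_insert_of_notMem (by simpa using h0)]
    simp [Nat.odd_add_one]
  · by_cases hxv : x = v
    · subst hxv
      have : G'.neighborSet x = insert u (G.neighborSet x) := by
        ext y
        simp only [mem_neighborSet, h, Set.mem_insert_iff, Sym2.eq_iff]
        grind
      rw [this, Set.ncard_insert_of_notMem (by simpa [G.adj_comm] using h0)]
      simp [Nat.odd_add_one]
    · have : G'.neighborSet x = G.neighborSet x := by
        ext y
        simp only [mem_neighborSet, h, Sym2.eq_iff]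
        grind
      rw [this]
      simp [hxu, hxv]

theorem od_delete {V : Type*} [Finite V] {G : SimpleGraph V} {u v : V} (h : G.Adj u v) (x : V) :
    Od (G.deleteEdges {s(u, v)}) x ↔ (Od G x ↔ ¬ (x = u ∨ x = v)) := by
  have := od_flip (G := G.deleteEdges {s(u, v)}) (G' := G) h.ne (by simp) (by
    intro a b
    simp only [deleteEdges_adj, Set.mem_singleton_iff]
    constructor
    · intro h; by_cases h' : s(a, b) = s(u, v) <;> simp [h, h']
    · rintro (h' | h')
      · exact h'.1
      · rw [← mem_edgeSet, h']; exact h) x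
  tauto

theorem od_exists_adj {V : Type*} [Finite V] {G : SimpleGraph V} {x : V} (h : Od G x) :
    ∃ z, G.Adj x z := by
  unfold Od at h
  have : (G.neighborSet x).Nonempty := Set.nonempty_of_ncard_ne_zero (by rintro h0; simp [h0] at h)
  exact this

theorem od_partner {V : Type*} [Finite V] (n : ℕ) : ∀ (G : SimpleGraph V), G.edgeSet.ncard = n →
    ∀ x, Od G x → ∃ y, y ≠ x ∧ Od G y ∧ G.Reachable x y := by
  induction n with
  | zero =>
    intro G hn x hx
    obtain ⟨z, hz⟩ := od_exists_adj hx
    rw [Set.ncard_eq_zero] at hn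
    have : s(x, z) ∈ G.edgeSet := hz
    simp [hn] at this
  | succ n ih =>
    intro G hn x hx
    obtain ⟨z, hz⟩ := od_exists_adj hx
    by_cases hzo : Od G z
    · exact ⟨z, hz.ne', hzo, hz.reachable⟩
    · have hc : (G.deleteEdges {s(x, z)}).edgeSet.ncard = n := by
        rw [edgeSet_deleteEdges, Set.ncard_sdiff_singleton_of_mem (by exact hz), hn]; rfl
      have hod := od_delete hz
      obtain ⟨y, hyz, hyo, hr⟩ := ih _ hc z (by rw [hod]; simp [hzo])
      rw [hod] at hyo
      have hyx : y ≠ x := by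
        rintro rfl
        simp [hx] at hyo
      refine ⟨y, hyx, by simpa [hyx, hyz] using hyo, hz.reachable.trans (hr.mono (deleteEdges_le _))⟩

theorem closed_trail {V : Type*} [Finite V] {G : SimpleGraph V} (hG : ∀ v, ¬ Od G v) {x y : V}
    (h : G.Adj x y) : ∃ p : G.Walk x x, p.IsTrail ∧ 0 < p.length := by
  have hod := od_delete h
  obtain ⟨z, hz, hzo, hr⟩ := od_partner _ _ rfl y ((hod y).2 (by simp [hG]))
  rw [hod] at hzo
  have hzx : z = x := by
    by_contra hne
    simp [hG, hne, hz] at hzo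
  subst hzx
  obtain ⟨p, hp⟩ := hr.exists_isPath
  refine ⟨.cons h (p.mapLe (deleteEdges_le _)), ?_, by simp⟩
  rw [Walk.isTrail_cons]
  refine ⟨(Walk.isTrail_mapLe _).2 hp.isTrail, ?_⟩
  rw [Walk.edges_mapLe_eq_edges]
  intro hm
  have := p.edges_subset_edgeSet hm
  simp at this

theorem od_trail {V : Type*} [Finite V] {G : SimpleGraph V} {a b : V} (p : G.Walk a b)
    (hp : p.IsTrail) (x : V) :
    Od (G.deleteEdges {e | e ∈ p.edges}) x ↔ (Od G x ↔ (x = a ↔ x = b)) := by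
  induction p with
  | nil => simp
  | @cons u v w h p ih =>
    rw [Walk.isTrail_cons] at hp
    have h1 : (G.deleteEdges {e | e ∈ (Walk.cons h p).edges}) =
        (G.deleteEdges {e | e ∈ p.edges}).deleteEdges {s(u, v)} := by
      rw [deleteEdges_deleteEdges]
      congr 1
      ext e
      simp
    rw [h1, od_delete (by simp [h, hp.2]), ih hp.1]
    have := h.ne
    by_cases hx : Od G x <;> by_cases h1 : x = u <;> by_cases h2 : x = v <;> by_cases h3 : x = w <;>
      simp_all

/-- A trail visiting all the given vertices. -/
theorem exists_trail {V : Type*} [Finite V] (H : SimpleGraph V) (A : Set V) (hA : A.Nonempty)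
    (hodA : ∀ v, Od H v → v ∈ A) (hr : ∀ x ∈ A, ∀ y ∈ A, H.Reachable x y)
    (hodd : {v | Od H v}.ncard ≤ 2) :
    ∃ (a b : V) (p : H.Walk a b), p.IsTrail ∧ ∀ v ∈ A, v ∈ p.support := by
  classical
  obtain ⟨a, b, haA, hbA, hab⟩ : ∃ a b, a ∈ A ∧ b ∈ A ∧ ∀ x, (Od H x ↔ ¬ (x = a ↔ x = b)) := by
    by_cases h : ∃ x, Od H x
    · obtain ⟨a, ha⟩ := h
      obtain ⟨b, hba, hb, -⟩ := od_partner _ _ rfl a ha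
      refine ⟨a, b, hodA _ ha, hodA _ hb, fun x => ⟨fun hx => ?_, fun hx => ?_⟩⟩
      · intro hx'
        have hxa : x ≠ a := by rintro rfl; exact hba (hx'.1 rfl).symm
        have hxb : x ≠ b := by rintro rfl; exact hba (hx'.2 rfl)
        have : ({a, b, x} : Set V).ncard ≤ 2 := by
          refine le_trans (Set.ncard_le_ncard ?_) hodd
          rintro y (rfl | rfl | rfl) <;> assumption
        rw [Set.ncard_eq_three.2 ⟨a, b, x, hba.symm, hxa.symm, hxb.symm, rfl⟩] at this
        omega
      · by_cases hxa : x = a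
        · exact hxa ▸ ha
        · by_cases hxb : x = b
          · exact hxb ▸ hb
          · simp [hxa, hxb] at hx
    · push Not at h
      obtain ⟨a, ha⟩ := hA
      exact ⟨a, a, ha, ha, fun x => by simp [h x]⟩
  let S : Set ℕ := {n | ∃ p : H.Walk a b, p.IsTrail ∧ p.length = n}
  have hSne : S.Nonempty := by
    obtain ⟨p, hp⟩ := (hr a haA b hbA).exists_isPath
    exact ⟨_, p, hp.isTrail, rfl⟩
  have hSb : BddAbove S := by
    have : Fintype H.edgeSet := Fintype.ofFinite _
    refine ⟨H.edgeFinset.card, ?_⟩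
    rintro n ⟨p, hp, rfl⟩
    exact hp.length_le_card_edgeFinset
  obtain ⟨p, hp, hpl⟩ := Nat.sSup_mem hSne hSb
  refine ⟨a, b, p, hp, fun y hy => ?_⟩
  by_contra hyp
  obtain ⟨q⟩ := hr a haA y hy
  obtain ⟨d, -, hd1, hd2⟩ := q.exists_boundary_dart {v | v ∈ p.support} (by simp) hyp
  simp only [Set.mem_ofPred_eq] at hd1 hd2
  have hev : ∀ v, ¬ Od (H.deleteEdges {e | e ∈ p.edges}) v := by
    intro v
    rw [od_trail p hp, hab]
    tauto
  have hadj : (H.deleteEdges {e | e ∈ p.edges}).Adj d.fst d.snd := by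
    rw [deleteEdges_adj]
    exact ⟨d.adj, fun hm => hd2 (p.snd_mem_support_of_mem_edges hm)⟩
  obtain ⟨c, hc, hcl, hce⟩ : ∃ c : H.Walk d.fst d.fst, c.IsTrail ∧ 0 < c.length ∧
      ∀ e ∈ c.edges, e ∉ p.edges := by
    obtain ⟨c, hc, hcl⟩ := closed_trail hev hadj
    refine ⟨c.mapLe (deleteEdges_le _), (Walk.isTrail_mapLe _).2 hc, by simpa [Walk.mapLe] using hcl,
      ?_⟩
    rw [Walk.edges_mapLe_eq_edges]
    intro e he
    have := c.edges_subset_edgeSet he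
    rw [edgeSet_deleteEdges] at this
    exact this.2
  obtain ⟨q, r, hqr⟩ := p.mem_support_iff_exists_append.mp hd1
  have hnew : (q.append (c.append r)).IsTrail := by
    rw [hqr] at hp
    rw [hqr] at hce
    simp only [Walk.isTrail_append, Walk.edges_append,
      List.disjoint_append_right, List.mem_append] at hp hce ⊢
    refine ⟨hp.1, ⟨hc, hp.2.1, ?_⟩, ?_, hp.2.2⟩
    · intro e h1 h2; exact hce e h1 (Or.inr h2)
    · intro e h1 h2; exact hce e h2 (Or.inl h1)
  have h1 := le_csSup hSb (show _ ∈ S from ⟨_, hnew, rfl⟩)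
  rw [← hpl, hqr] at h1
  simp only [Walk.length_append] at h1
  omega

/-! ### Dominating trails give hamiltonian paths in the line graph -/

theorem traceable_of_list {α : Type*} {G : SimpleGraph α} (l : List α) (hne : l ≠ [])
    (hc : l.IsChain G.Adj) (hn : l.Nodup) (hall : ∀ w, w ∈ l) : Traceable G := by
  refine ⟨_, _, Walk.ofSupport l hne hc, ?_, ?_⟩
  · rw [Walk.isPath_def, Walk.support_ofSupport]; exact hn
  · rw [Walk.support_ofSupport]; exact hall

theorem line_adj_of_mem {V : Type*} {G : SimpleGraph V} {e f : G.edgeSet} (hne : e ≠ f) {v : V}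
    (he : v ∈ (e : Sym2 V)) (hf : v ∈ (f : Sym2 V)) : G.lineGraph.Adj e f := by
  rw [lineGraph_adj_iff_exists]
  exact ⟨hne, v, he, hf⟩

theorem hnw_list {V : Type*} [Finite V] {G : SimpleGraph V} {a b : V} (p : G.Walk a b)
    (hp : p.IsTrail) : ∀ (F : Finset G.edgeSet), (∀ e ∈ F, (e : Sym2 V) ∉ p.edges) →
    (∀ e ∈ F, ∃ v ∈ p.support, v ∈ (e : Sym2 V)) →
    ∃ l : List G.edgeSet, l.Nodup ∧ l.IsChain G.lineGraph.Adj ∧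
      (∀ e, e ∈ l ↔ e ∈ F ∨ (e : Sym2 V) ∈ p.edges) ∧ (∀ e ∈ l.head?, a ∈ (e : Sym2 V)) := by
  classical
  have key : ∀ (u : V) (F : Finset G.edgeSet), (∀ e ∈ F, u ∈ (e : Sym2 V)) →
      F.toList.IsChain G.lineGraph.Adj := by
    intro u F hF
    apply List.Pairwise.isChain
    have h1 := F.nodup_toList
    refine List.Pairwise.imp_of_mem ?_ h1
    intro e f he hf hne
    exact line_adj_of_mem hne (hF e (by simpa using he)) (hF f (by simpa using hf))
  induction p with
  | @nil u =>
    intro F h1 h2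
    have hF : ∀ e ∈ F, u ∈ (e : Sym2 V) := by
      intro e he
      obtain ⟨v, hv, hve⟩ := h2 e he
      simp at hv
      exact hv ▸ hve
    refine ⟨F.toList, F.nodup_toList, key u F hF, by simp, ?_⟩
    intro e he
    exact hF e (by simpa using List.mem_of_mem_head? he)
  | @cons u v w h p ih =>
    intro F h1 h2
    rw [Walk.isTrail_cons] at hp
    obtain ⟨l, hl1, hl2, hl3, hl4⟩ := ih hp.1 (F.filter fun e => u ∉ (e : Sym2 V))
      (by
        intro e he hm
        rw [Finset.mem_filter] at he
        exact h1 e he.1 (by simp [hm]))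
      (by
        intro e he
        rw [Finset.mem_filter] at he
        obtain ⟨x, hx, hxe⟩ := h2 e he.1
        rw [Walk.support_cons, List.mem_cons] at hx
        rcases hx with rfl | hx
        · exact absurd hxe he.2
        · exact ⟨x, hx, hxe⟩)
    let e0 : G.edgeSet := ⟨s(u, v), h⟩
    let Fu : Finset G.edgeSet := F.filter fun e => u ∈ (e : Sym2 V)
    have hFu : ∀ e ∈ Fu, u ∈ (e : Sym2 V) := fun e he => (Finset.mem_filter.1 he).2
    have he0F : e0 ∉ F := fun hm => h1 e0 hm (by simp [e0])
    have he0l : e0 ∉ l := by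
      rw [hl3]
      rintro (hm | hm)
      · exact he0F (Finset.mem_filter.1 hm).1
      · exact hp.2 hm
    refine ⟨Fu.toList ++ e0 :: l, ?_, ?_, ?_, ?_⟩
    · rw [List.nodup_append]
      refine ⟨Fu.nodup_toList, List.nodup_cons.2 ⟨he0l, hl1⟩, ?_⟩
      rintro e he f hf rfl
      rw [Finset.mem_toList] at he
      rw [List.mem_cons, hl3] at hf
      have heF := (Finset.mem_filter.1 he).1
      rcases hf with rfl | hf | hf
      · exact he0F heF
      · exact (Finset.mem_filter.1 hf).2 (hFu e he)
      · exact h1 e heF (by simp [hf])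
    · rw [List.isChain_append]
      refine ⟨key u Fu hFu, ?_, ?_⟩
      · rw [List.isChain_cons]
        refine ⟨?_, hl2⟩
        intro f hf
        refine line_adj_of_mem (v := v) ?_ (by simp [e0]) (hl4 f hf)
        rintro rfl
        exact he0l (List.mem_of_mem_head? hf)
      · intro e he f hf
        simp at hf
        subst hf
        have he' : e ∈ Fu := by simpa using List.mem_of_mem_getLast? he
        refine line_adj_of_mem (v := u) ?_ (hFu e he') (by simp [e0])
        rintro rfl
        exact he0F (Finset.mem_filter.1 he').1
    · intro e
      simp only [List.mem_append, Finset.mem_toList, List.mem_cons, hl3, Fu, Finset.mem_filter,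
        Walk.edges_cons, e0, Subtype.ext_iff]
      tauto
    · intro e he
      by_cases hemp : Fu.toList = []
      · rw [hemp] at he
        simp at he
        subst he
        simp [e0]
      · rw [List.head?_append_of_ne_nil _ hemp] at he
        exact hFu e (by simpa using List.mem_of_mem_head? he)

theorem hnw {V : Type*} [Finite V] {G : SimpleGraph V} {a b : V} (p : G.Walk a b)
    (hp : p.IsTrail) (hdom : ∀ e ∈ G.edgeSet, ∃ v ∈ p.support, v ∈ e)
    (hne : G.edgeSet.Nonempty) : Traceable G.lineGraph := by
  classical
  have : Fintype G.edgeSet := Fintype.ofFinite _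
  obtain ⟨l, hl1, hl2, hl3, -⟩ := hnw_list p hp
    (Finset.univ.filter fun e : G.edgeSet => (e : Sym2 V) ∉ p.edges) (by simp)
    (fun e _ => hdom e e.2)
  have hall : ∀ e, e ∈ l := by
    intro e
    rw [hl3]
    simp
    tauto
  obtain ⟨e, he⟩ := hne
  exact traceable_of_list l (List.ne_nil_of_mem (hall ⟨e, he⟩)) hl2 hl1 hall

/-- The final step. -/
theorem final_step {V : Type*} [Finite V] (G H : SimpleGraph V) (A : Set V) (hle : H ≤ G)
    (hodA : ∀ v, Od H v → v ∈ A) (hr : ∀ x ∈ A, ∀ y ∈ A, H.Reachable x y)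
    (hodd : {v | Od H v}.ncard ≤ 2) (hdom : ∀ u v, G.Adj u v → u ∈ A ∨ v ∈ A)
    (hne : G.edgeSet.Nonempty) : Traceable G.lineGraph := by
  have hA : A.Nonempty := by
    obtain ⟨e, he⟩ := hne
    induction e with | _ u v
    rcases hdom u v he with h | h <;> exact ⟨_, h⟩
  obtain ⟨a, b, p, hp, hpA⟩ := exists_trail H A hA hodA hr hodd
  refine hnw (p.mapLe hle) ((Walk.isTrail_mapLe _).2 hp) ?_ hne
  intro e he
  induction e with | _ u v
  rw [Walk.support_mapLe_eq_support]
  rcases hdom u v he with h | h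
  · exact ⟨u, hpA _ h, by simp⟩
  · exact ⟨v, hpA _ h, by simp⟩

/-! ### Connected subgraphs of cliques with prescribed parities -/

theorem clique_extend {V : Type*} [Finite V] {X O : Set V} {F : SimpleGraph V} {x y : V}
    (hx : x ∉ X) (hy : y ∈ X)
    (h1 : ∀ a b, F.Adj a b → a ∈ X ∧ b ∈ X) (h2 : ∀ a ∈ X, ∀ b ∈ X, F.Reachable a b)
    (h3 : ∀ a, Od F a ↔ a ∈ O) :
    ∃ F' : SimpleGraph V, F ≤ F' ∧ (∀ a b, F'.Adj a b ↔ F.Adj a b ∨ s(a, b) = s(x, y)) ∧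
      (∀ a b, F'.Adj a b → a ∈ insert x X ∧ b ∈ insert x X) ∧
      (∀ a ∈ insert x X, ∀ b ∈ insert x X, F'.Reachable a b) ∧
      (∀ a, Od F' a ↔ (a ∈ O ↔ ¬ (a = x ∨ a = y))) := by
  have hxy : x ≠ y := by rintro rfl; exact hx hy
  have hadj : ∀ a b, (F ⊔ edge x y).Adj a b ↔ F.Adj a b ∨ s(a, b) = s(x, y) := by
    intro a b
    simp only [sup_adj, edge_adj, Sym2.eq_iff]
    grind
  have hr : ∀ a ∈ insert x X, (F ⊔ edge x y).Reachable a y := by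
    rintro a (rfl | ha)
    · exact Adj.reachable (by rw [hadj]; simp)
    · exact (h2 a ha y hy).mono le_sup_left
  refine ⟨F ⊔ edge x y, le_sup_left, hadj, ?_, ?_, ?_⟩
  · intro a b hab
    rw [hadj, Sym2.eq_iff] at hab
    have := h1 a b
    grind
  · intro a ha b hb
    exact (hr a ha).trans (hr b hb).symm
  · intro a
    rw [od_flip hxy (fun h => hx (h1 _ _ h).1) hadj, h3]

theorem clique_odd {V : Type*} [Finite V] (n : ℕ) : ∀ X O : Set V, X.ncard = n → O ⊆ X →
    Even O.ncard → (O.Nonempty ∨ X.ncard ≤ 1) →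
    ∃ F : SimpleGraph V, (∀ a b, F.Adj a b → a ∈ X ∧ b ∈ X) ∧
      (∀ a ∈ X, ∀ b ∈ X, F.Reachable a b) ∧ (∀ a, Od F a ↔ a ∈ O) := by
  induction n with
  | zero =>
    intro X O hn hO hev h
    rw [Set.ncard_eq_zero] at hn
    subst hn
    refine ⟨⊥, by simp, by simp, ?_⟩
    rw [Set.subset_empty_iff] at hO
    subst hO
    simp [Od]
  | succ n ih =>
    intro X O hn hO hev h
    rcases Set.eq_empty_or_nonempty O with rfl | ⟨x, hx⟩
    · have h1 : X.ncard ≤ 1 := by simpa using h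
      rw [Set.ncard_le_one] at h1
      refine ⟨⊥, by simp, ?_, by simp [Od]⟩
      intro a ha b hb
      rw [h1 a ha b hb]
    · have hxX := hO hx
      have hX' : (X \ {x}).ncard = n := by
        rw [Set.ncard_sdiff_singleton_of_mem hxX, hn]; rfl
      have hins : insert x (X \ {x}) = X := by simp [hxX]
      have hOx : (O \ {x}).ncard + 1 = O.ncard := Set.ncard_sdiff_singleton_add_one hx
      by_cases hy : ∃ y ∈ X, y ∉ O
      · obtain ⟨y, hyX, hyO⟩ := hy
        have hyx : y ≠ x := by rintro rfl; exact hyO hx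
        obtain ⟨F, h1, h2, h3⟩ := ih (X \ {x}) (insert y (O \ {x})) hX'
          (by
            rintro a (rfl | ha)
            · exact ⟨hyX, hyx⟩
            · exact ⟨hO ha.1, ha.2⟩)
          (by
            rw [Set.ncard_insert_of_notMem (by simp [hyO]), hOx]; exact hev) (Or.inl ⟨y, by simp⟩)
        obtain ⟨F', -, -, g1, g2, g3⟩ := clique_extend (X := X \ {x}) (x := x) (y := y) (by simp)
          ⟨hyX, hyx⟩ h1 h2 h3
        rw [hins] at g1 g2
        refine ⟨F', g1, g2, fun a => ?_⟩
        rw [g3]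
        simp only [Set.mem_insert_iff, Set.mem_sdiff, Set.mem_singleton_iff]
        grind
      · push Not at hy
        obtain rfl : X = O := Set.Subset.antisymm hy hO
        have hne : (X \ {x}).Nonempty := by
          apply Set.nonempty_of_ncard_ne_zero
          intro h0
          rw [← hOx, h0] at hev
          simp at hev
        obtain ⟨y, hyX, hyx⟩ := hne
        have hc2 : ((X \ {x}) \ {y}).ncard + 1 = (X \ {x}).ncard :=
          Set.ncard_sdiff_singleton_add_one ⟨hyX, hyx⟩
        obtain ⟨F, h1, h2, h3⟩ := ih (X \ {x}) ((X \ {x}) \ {y}) hX' Set.sdiff_subset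
          (by
            rw [← hOx, ← hc2] at hev
            simpa [Nat.even_add_one] using hev)
          (by
            rcases Set.eq_empty_or_nonempty ((X \ {x}) \ {y}) with h0 | h0
            · right
              rw [← hc2, h0]; simp
            · exact Or.inl h0)
        obtain ⟨F', -, -, g1, g2, g3⟩ := clique_extend (X := X \ {x}) (x := x) (y := y) (by simp)
          ⟨hyX, hyx⟩ h1 h2 h3
        rw [hins] at g1 g2
        refine ⟨F', g1, g2, fun a => ?_⟩
        rw [g3]
        simp only [Set.mem_sdiff, Set.mem_singleton_iff] at hyx ⊢
        grind

theorem clique_all {V : Type*} [Finite V] (X O : Set V) (hO : O ⊆ X)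
    (hev : Even O.ncard) (h : O.Nonempty ∨ X.ncard ≠ 2) :
    ∃ F : SimpleGraph V, (∀ a b, F.Adj a b → a ∈ X ∧ b ∈ X) ∧
      (∀ a ∈ X, ∀ b ∈ X, F.Reachable a b) ∧ (∀ a, Od F a ↔ a ∈ O) := by
  rcases Set.eq_empty_or_nonempty O with rfl | h0
  · by_cases h1 : X.ncard ≤ 1
    · exact clique_odd _ X ∅ rfl hO hev (Or.inr h1)
    · have h3 : 2 < X.ncard := by
        simp at h
        omega
      obtain ⟨x, hx, y, hy, z, hz, hxy, hxz, hyz⟩ := (Set.two_lt_ncard).1 h3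
      obtain ⟨F, h1, h2, h3⟩ := clique_odd _ (X \ {x}) {y, z} rfl
        (by rintro a (rfl | rfl) <;> simp [*, Ne.symm])
        (by rw [Set.ncard_pair hyz]; simp) (Or.inl ⟨y, by simp⟩)
      obtain ⟨F', -, g0, g1, g2, g3⟩ := clique_extend (X := X \ {x}) (x := x) (y := y) (by simp)
        ⟨hy, hxy.symm⟩ h1 h2 h3
      have hins : insert x (X \ {x}) = X := by simp [hx]
      rw [hins] at g1 g2
      have hadj : ∀ a b, (F' ⊔ edge x z).Adj a b ↔ F'.Adj a b ∨ s(a, b) = s(x, z) := by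
        intro a b
        simp only [sup_adj, edge_adj, Sym2.eq_iff]
        grind
      refine ⟨F' ⊔ edge x z, ?_, fun a ha b hb => (g2 a ha b hb).mono le_sup_left, fun a => ?_⟩
      · intro a b hab
        rw [hadj, Sym2.eq_iff] at hab
        have := g1 a b
        grind
      · rw [od_flip hxz ?_ hadj, g3]
        · simp only [Set.mem_insert_iff, Set.mem_singleton_iff, Set.mem_empty_iff_false]
          grind
        · rw [g0]
          rintro (h | h)
          · exact absurd (h1 _ _ h).1 (by simp)
          · rw [Sym2.eq_iff] at h
            grind
  · exact clique_odd _ X O rfl hO hev (Or.inl h0)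

/-! ### The invariant -/

/-- Non-backtracking walk on `n + 2` vertices outside of `A`, starting with `u, v`. -/
def Run {V : Type*} (G : SimpleGraph V) (A : Set V) : ℕ → V → V → Prop
  | 0, u, v => u ∉ A ∧ v ∉ A ∧ G.Adj u v
  | n + 1, u, v => u ∉ A ∧ G.Adj u v ∧ ∃ w, w ≠ u ∧ Run G A n v w

theorem Run.adj {V : Type*} {G : SimpleGraph V} {A : Set V} {n : ℕ} {u v : V}
    (h : Run G A n u v) : G.Adj u v := by
  cases n with
  | zero => exact h.2.2
  | succ n => exact h.2.1

theorem Run.notMem {V : Type*} {G : SimpleGraph V} {A : Set V} {n : ℕ} {u v : V}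
    (h : Run G A n u v) : u ∉ A := by
  cases n with
  | zero => exact h.1
  | succ n => exact h.1

/-- The invariant of the induction: `H` is a subgraph with at most two odd vertices, `A` a set of
active vertices; all other vertices lie on short runs, and the active vertices are nearly
connected by `H`. -/
structure Inv {V : Type*} (G H : SimpleGraph V) (A : Set V) (j : ℕ) : Prop where
  le : H ≤ G
  odd : {v | Od H v}.ncard ≤ 2
  hA : ∀ u v, H.Adj u v → u ∈ A
  idle : ∀ u, u ∉ A → ∀ a b c, G.Adj u a → G.Adj u b → G.Adj u c → a = b ∨ a = c ∨ b = c
  act : ∀ u ∈ A, ∀ a b, a ≠ b → G.Adj u a → G.Adj u b →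
    (∃ c, H.Adj u c) ∨ ∃ c, c ≠ a ∧ c ≠ b ∧ G.Adj u c
  run : ∀ u v, ¬ Run G A j u v
  conn : ∀ S : Set V, (∀ u v, H.Adj u v → u ∈ S → v ∈ S) → (∃ a ∈ A, a ∈ S) → (∃ b ∈ A, b ∉ S) →
    ∃ a b, a ∈ A ∧ a ∈ S ∧ b ∈ A ∧ b ∉ S ∧ ∃ p : G.Walk a b, p.length ≤ j
  tri : ∃ e f g : G.edgeSet, G.lineGraph.Adj e f ∧ G.lineGraph.Adj f g ∧ G.lineGraph.Adj e g

theorem local_data {V : Type*} [Finite V] {G H : SimpleGraph V} {A : Set V} {j : ℕ}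
    (hI : Inv G H A j) (u : V) : ∃ (F : SimpleGraph V) (c : V),
      (∀ a b, F.Adj a b → u ∈ A ∧ G.Adj u a ∧ G.Adj u b) ∧
      (u ∈ A → ∀ a b, G.Adj u a → G.Adj u b → F.Reachable a b) ∧
      (∀ x, (Od F x ↔ H.Adj u x) ∨ (Od H u ∧ x = c)) := by
  by_cases hu : u ∈ A
  swap
  · refine ⟨⊥, u, by simp, fun h => absurd h hu, fun x => Or.inl ?_⟩
    have : ¬ H.Adj u x := fun h => hu (hI.hA _ _ h)
    simp [Od, this]
  have hsub : H.neighborSet u ⊆ G.neighborSet u := fun x hx => hI.le hx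
  by_cases ho : Od H u
  · by_cases h2 : (G.neighborSet u).ncard = 2
    · have hlt : (H.neighborSet u).ncard < (G.neighborSet u).ncard := by
        refine lt_of_le_of_ne (Set.ncard_le_ncard hsub) ?_
        intro h
        unfold Od at ho
        rw [h, h2] at ho
        exact absurd ho (by decide)
      obtain ⟨c, hcG, hcH⟩ := Set.exists_mem_notMem_of_ncard_lt_ncard hlt
      obtain ⟨F, h1, h2, h3⟩ := clique_all (G.neighborSet u) (insert c (H.neighborSet u))
        (Set.insert_subset hcG hsub)
        (by
          rw [Set.ncard_insert_of_notMem hcH]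
          exact Odd.add_one ho) (Or.inl ⟨c, by simp⟩)
      refine ⟨F, c, fun a b hab => ⟨hu, h1 a b hab⟩, fun _ a b ha hb => h2 a ha b hb, fun x => ?_⟩
      rw [h3]
      simp only [Set.mem_insert_iff, mem_neighborSet]
      tauto
    · obtain ⟨c, hc⟩ := od_exists_adj ho
      obtain ⟨F, h1, h2, h3⟩ := clique_all (G.neighborSet u) (H.neighborSet u \ {c})
        (Set.sdiff_subset.trans hsub)
        (by
          have := Set.ncard_sdiff_singleton_add_one (s := H.neighborSet u) (a := c) hc
          unfold Od at ho
          rw [← this] at ho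
          simpa [Nat.odd_add_one] using ho) (Or.inr h2)
      refine ⟨F, c, fun a b hab => ⟨hu, h1 a b hab⟩, fun _ a b ha hb => h2 a ha b hb, fun x => ?_⟩
      rw [h3]
      simp only [Set.mem_sdiff, Set.mem_singleton_iff, mem_neighborSet]
      tauto
  · obtain ⟨F, h1, h2, h3⟩ := clique_all (G.neighborSet u) (H.neighborSet u) hsub
      (by simpa [Od] using ho)
      (by
        by_contra! hcon
        obtain ⟨a, b, hab, hX⟩ := Set.ncard_eq_two.1 hcon.2
        have hmem : ∀ x, G.Adj u x ↔ x = a ∨ x = b := by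
          intro x
          rw [← mem_neighborSet, hX]; simp
        rcases hI.act u hu a b hab ((hmem a).2 (by simp)) ((hmem b).2 (by simp)) with
          ⟨c, hc⟩ | ⟨c, h1, h2, h3⟩
        · have : c ∈ H.neighborSet u := hc
          rw [hcon.1] at this
          simp at this
        · rw [hmem] at h3
          tauto)
    refine ⟨F, u, fun a b hab => ⟨hu, h1 a b hab⟩, fun _ a b ha hb => h2 a ha b hb, fun x => ?_⟩
    rw [h3]
    simp

/-- The subgraph of the line graph glued from graphs on the neighbourhoods. -/
def glue {V : Type*} (G : SimpleGraph V) (F : V → SimpleGraph V) : SimpleGraph G.edgeSet where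
  Adj e f := ∃ u a b, (e : Sym2 V) = s(u, a) ∧ (f : Sym2 V) = s(u, b) ∧ (F u).Adj a b
  symm := ⟨by
    rintro e f ⟨u, a, b, h1, h2, h3⟩
    exact ⟨u, b, a, h2, h1, h3.symm⟩⟩
  loopless := ⟨by
    rintro e ⟨u, a, b, h1, h2, h3⟩
    rw [h1, Sym2.congr_right] at h2
    exact h3.ne h2⟩

theorem od_glue {V : Type*} [Finite V] {G : SimpleGraph V} {F : V → SimpleGraph V}
    (hF : ∀ u a b, (F u).Adj a b → G.Adj u a ∧ G.Adj u b) {u v : V} (h : G.Adj u v) :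
    Od (glue G F) ⟨s(u, v), h⟩ ↔ ¬ (Od (F u) v ↔ Od (F v) u) := by
  have hset : (Subtype.val '' (glue G F).neighborSet ⟨s(u, v), h⟩ : Set (Sym2 V)) =
      (fun a => s(u, a)) '' (F u).neighborSet v ∪ (fun a => s(v, a)) '' (F v).neighborSet u := by
    ext f
    constructor
    · rintro ⟨⟨f, hf⟩, ⟨w, a, b, h1, h2, h3⟩, rfl⟩
      simp only at h1 h2
      rw [Sym2.eq_iff] at h1
      rcases h1 with ⟨rfl, rfl⟩ | ⟨rfl, rfl⟩
      · exact Or.inl ⟨b, h3, h2.symm⟩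
      · exact Or.inr ⟨b, h3, h2.symm⟩
    · rintro (⟨b, hb, rfl⟩ | ⟨b, hb, rfl⟩)
      · exact ⟨⟨s(u, b), (hF _ _ _ hb).2⟩, ⟨u, v, b, rfl, rfl, hb⟩, rfl⟩
      · exact ⟨⟨s(v, b), (hF _ _ _ hb).2⟩, ⟨v, u, b, Sym2.eq_swap, rfl, hb⟩, rfl⟩
  have hdisj : Disjoint ((fun a => s(u, a)) '' (F u).neighborSet v)
      ((fun a => s(v, a)) '' (F v).neighborSet u) := by
    rw [Set.disjoint_left]
    rintro _ ⟨a, ha, rfl⟩ ⟨b, hb, hab⟩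
    simp only [Sym2.eq_iff] at hab
    have h1 := h.ne
    have h2 : (F u).Adj v a := ha
    have h3 := h2.ne
    grind
  have hcard := congrArg Set.ncard hset
  rw [Set.ncard_image_of_injective _ Subtype.val_injective, Set.ncard_union_eq hdisj,
    Set.ncard_image_of_injective _ (fun a b hab => Sym2.congr_right.1 hab),
    Set.ncard_image_of_injective _ (fun a b hab => Sym2.congr_right.1 hab)] at hcard
  unfold Od
  rw [hcard, Nat.odd_add, ← Nat.not_odd_iff_even]
  tauto

theorem line_adj_cases {V : Type*} {G : SimpleGraph V} {e f : G.edgeSet} {u v : V}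
    (he : (e : Sym2 V) = s(u, v)) (h : G.lineGraph.Adj e f) :
    (∃ a, a ≠ v ∧ (f : Sym2 V) = s(u, a) ∧ G.Adj u a) ∨
    (∃ a, a ≠ u ∧ (f : Sym2 V) = s(v, a) ∧ G.Adj v a) := by
  rw [lineGraph_adj_iff_exists] at h
  obtain ⟨hne, w, h1, h2⟩ := h
  obtain ⟨a, ha⟩ := Sym2.mem_iff_exists.1 h2
  have hadj : G.Adj w a := by
    have := f.2
    rwa [ha] at this
  rw [he, Sym2.mem_iff] at h1
  rcases h1 with rfl | rfl
  · refine Or.inl ⟨a, ?_, ha, hadj⟩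
    rintro rfl
    exact hne (Subtype.ext (he.trans ha.symm))
  · refine Or.inr ⟨a, ?_, ha, hadj⟩
    rintro rfl
    exact hne (Subtype.ext (he.trans (Sym2.eq_swap.trans ha.symm)))

theorem run_line {V : Type*} {G : SimpleGraph V} {A : Set V}
    (hidle : ∀ u, u ∉ A → ∀ a b c, G.Adj u a → G.Adj u b → G.Adj u c → a = b ∨ a = c ∨ b = c)
    (n : ℕ) : ∀ (e f : G.edgeSet) (u v w : V), (e : Sym2 V) = s(u, v) → (f : Sym2 V) = s(v, w) →
      Run G.lineGraph {e | ∃ x ∈ A, x ∈ (e : Sym2 V)} n e f → Run G A n v w := by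
  induction n with
  | zero =>
    intro e f u v w he hf hr
    have hfr : f ∉ {e : G.edgeSet | ∃ x ∈ A, x ∈ (e : Sym2 V)} := hr.2.1
    have hadj : G.Adj v w := by
      have := f.2
      rwa [hf] at this
    exact ⟨fun h => hfr ⟨v, h, by simp [hf]⟩, fun h => hfr ⟨w, h, by simp [hf]⟩, hadj⟩
  | succ n ih =>
    rintro e f u v w he hf ⟨h1, h2, g, hge, hr⟩
    have hadj : G.Adj v w := by
      have := f.2
      rwa [hf] at this
    have hadj' : G.Adj u v := by
      have := e.2
      rwa [he] at this
    have hv : v ∉ A := fun h => h1 ⟨v, h, by simp [he]⟩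
    refine ⟨hv, hadj, ?_⟩
    rcases line_adj_cases hf hr.adj with ⟨a, haw, hg, hva⟩ | ⟨a, hav, hg, hwa⟩
    · exfalso
      have hau : a ≠ u := by
        rintro rfl
        exact hge (Subtype.ext (hg.trans (Sym2.eq_swap.trans he.symm)))
      have huw : u ≠ w := by
        rintro rfl
        exact h2.ne (Subtype.ext (he.trans (Sym2.eq_swap.trans hf.symm)))
      rcases hidle v hv a u w hva hadj'.symm hadj with h | h | h <;> contradiction
    · exact ⟨a, hav, ih f g v w a hf hg hr⟩

theorem walk_line {V : Type*} {G : SimpleGraph V} (n : ℕ) : ∀ {a b : V} (p : G.Walk a b),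
    p.length ≤ n + 1 → a ≠ b → ∃ e f : G.edgeSet, a ∈ (e : Sym2 V) ∧ b ∈ (f : Sym2 V) ∧
      ∃ q : G.lineGraph.Walk e f, q.length ≤ n := by
  induction n with
  | zero =>
    intro a b p hp hab
    cases p with
    | nil => exact absurd rfl hab
    | @cons _ v _ h p =>
      have : p.length = 0 := by simpa using hp
      have := Walk.eq_of_length_eq_zero this
      subst this
      exact ⟨⟨s(a, v), h⟩, ⟨s(a, v), h⟩, by simp, by simp, .nil, by simp⟩
  | succ n ih =>
    intro a b p hp hab
    cases p with
    | nil => exact absurd rfl hab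
    | @cons _ v _ h p =>
      by_cases hvb : v = b
      · subst hvb
        exact ⟨⟨s(a, v), h⟩, ⟨s(a, v), h⟩, by simp, by simp, .nil, by simp⟩
      · obtain ⟨e, f, he, hf, q, hq⟩ := ih p (by simpa using hp) hvb
        by_cases hee : (⟨s(a, v), h⟩ : G.edgeSet) = e
        · exact ⟨e, f, by simp [← hee], hf, q, by omega⟩
        · exact ⟨⟨s(a, v), h⟩, f, by simp, hf,
            .cons (line_adj_of_mem hee (v := v) (by simp) he) q, by simpa using hq⟩

theorem step {V : Type*} [Finite V] {G H : SimpleGraph V} {A : Set V} {j : ℕ}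
    (hI : Inv G H A (j + 1)) : ∃ (H' : SimpleGraph G.edgeSet) (A' : Set G.edgeSet),
      Inv G.lineGraph H' A' j := by
  choose F c hF1 hF2 hF3 using local_data hI
  have hF0 : ∀ u a b, (F u).Adj a b → G.Adj u a ∧ G.Adj u b := fun u a b h => (hF1 u a b h).2
  have hadj : ∀ {u v : V} {e : G.edgeSet}, (e : Sym2 V) = s(u, v) → G.Adj u v := by
    intro u v e he
    have := e.2
    rwa [he] at this
  -- all edges at an active vertex are joined in the glued graph
  have hreach : ∀ (S : Set G.edgeSet), (∀ e f, (glue G F).Adj e f → e ∈ S → f ∈ S) →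
      ∀ u ∈ A, ∀ e f : G.edgeSet, u ∈ (e : Sym2 V) → u ∈ (f : Sym2 V) → e ∈ S → f ∈ S := by
    intro S hS u hu e f he hf heS
    obtain ⟨a, ha⟩ := Sym2.mem_iff_exists.1 he
    obtain ⟨b, hb⟩ := Sym2.mem_iff_exists.1 hf
    have hr := hF2 u hu a b (hadj ha) (hadj hb)
    obtain ⟨p⟩ := hr
    clear he hf
    induction p generalizing e with
    | nil => rwa [Subtype.ext (hb.trans ha.symm)]
    | @cons x y z h p ih =>
      refine ih ⟨s(u, y), (hF0 _ _ _ h).2⟩ ?_ rfl hb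
      exact hS e _ ⟨u, x, y, ha, rfl, h⟩ heS
  have hnbr : ∀ (e : G.edgeSet) (u v a : V), (e : Sym2 V) = s(u, v) → u ∈ A → G.Adj u a → a ≠ v →
      ∃ f, (glue G F).Adj e f := by
    intro e u v a he hu ha hav
    obtain ⟨p⟩ := hF2 u hu v a (hadj he) ha
    cases p with
    | nil => exact absurd rfl hav
    | @cons _ y _ h p =>
      exact ⟨⟨s(u, y), (hF0 _ _ _ h).2⟩, u, v, y, he, rfl, h⟩
  refine ⟨glue G F, {e | ∃ x ∈ A, x ∈ (e : Sym2 V)}, ?_, ?_, ?_, ?_, ?_, ?_, ?_, ?_⟩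
  · rintro e f ⟨u, a, b, h1, h2, h3⟩
    refine line_adj_of_mem (v := u) ?_ (by simp [h1]) (by simp [h2])
    rintro rfl
    rw [h1, Sym2.congr_right] at h2
    exact h3.ne h2
  · have hsub : (Subtype.val '' {e | Od (glue G F) e} : Set (Sym2 V)) ⊆
        (fun x => s(x, c x)) '' {v | Od H v} := by
      rintro _ ⟨⟨e, he⟩, ho, rfl⟩
      induction e with | _ u v
      have ho' := (od_glue hF0 (u := u) (v := v) he).1 ho
      have h1 := hF3 u v
      have h2 := hF3 v u
      rw [H.adj_comm v u] at h2
      rcases h1 with h1 | ⟨h1, rfl⟩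
      · rcases h2 with h2 | ⟨h2, rfl⟩
        · exact absurd (h1.trans h2.symm) ho'
        · exact ⟨v, h2, Sym2.eq_swap⟩
      · exact ⟨u, h1, rfl⟩
    rw [← Set.ncard_image_of_injective _ Subtype.val_injective]
    exact (Set.ncard_le_ncard hsub).trans ((Set.ncard_image_le).trans hI.odd)
  · rintro e f ⟨u, a, b, h1, h2, h3⟩
    exact ⟨u, (hF1 _ _ _ h3).1, by simp [h1]⟩
  · rintro ⟨e, hee⟩ he f1 f2 f3 h1 h2 h3
    induction e with | _ u v
    have huv : G.Adj u v := hee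
    have hu : u ∉ A := fun h => he ⟨u, h, by simp⟩
    have hv : v ∉ A := fun h => he ⟨v, h, by simp⟩
    have key : ∀ x y, x ∉ A → G.Adj x y → ∀ a b : V, a ≠ y → b ≠ y → G.Adj x a → G.Adj x b → a = b := by
      intro x y hx hxy a b ha hb hxa hxb
      rcases hI.idle x hx a b y hxa hxb hxy with h | h | h
      · exact h
      · exact absurd h ha
      · exact absurd h hb
    have ku := key u v hu huv
    have kv := key v u hv huv.symm
    have := line_adj_cases rfl h1
    have := line_adj_cases rfl h2
    have := line_adj_cases rfl h3
    simp only [Subtype.ext_iff]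
    grind
  · rintro ⟨e, hee⟩ ⟨x, hxA, hxe⟩ f1 f2 hne h1 h2
    left
    obtain ⟨v, rfl⟩ := Sym2.mem_iff_exists.1 hxe
    have hadj' : G.Adj x v := hee
    by_contra hno
    have hN : ∀ a, G.Adj x a → a = v := by
      intro a ha
      by_contra hav
      exact hno (hnbr _ x v a rfl hxA ha hav)
    obtain ⟨a, ha, hfa, hva⟩ : ∃ a, a ≠ x ∧ (f1 : Sym2 V) = s(v, a) ∧ G.Adj v a := by
      rcases line_adj_cases rfl h1 with ⟨a, h, -, h'⟩ | h
      · exact absurd (hN a h') h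
      · exact h
    obtain ⟨b, hb, hfb, hvb⟩ : ∃ a, a ≠ x ∧ (f2 : Sym2 V) = s(v, a) ∧ G.Adj v a := by
      rcases line_adj_cases rfl h2 with ⟨a, h, -, h'⟩ | h
      · exact absurd (hN a h') h
      · exact h
    have hab : a ≠ b := by
      rintro rfl
      exact hne (Subtype.ext (hfa.trans hfb.symm))
    by_cases hvA : v ∈ A
    · exact hno (hnbr _ v x a Sym2.eq_swap hvA hva ha)
    · rcases hI.idle v hvA a b x hva hvb hadj'.symm with h | h | h <;> contradiction
  · intro e f hr
    obtain ⟨hne, v, h1, h2⟩ := (lineGraph_adj_iff_exists).1 hr.adj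
    obtain ⟨u, hu⟩ := Sym2.mem_iff_exists.1 h1
    obtain ⟨w, hw⟩ := Sym2.mem_iff_exists.1 h2
    have hr' := run_line hI.idle j e f u v w (hu.trans Sym2.eq_swap) hw hr
    refine hI.run u v ⟨?_, (hadj hu).symm, w, ?_, hr'⟩
    · exact fun h => hr.notMem ⟨u, h, by simp [hu]⟩
    · rintro rfl
      exact hne (Subtype.ext (hu.trans hw.symm))
  · rintro S hS ⟨e, ⟨x, hxA, hxe⟩, heS⟩ ⟨f, ⟨y, hyA, hyf⟩, hfS⟩
    obtain ⟨a, b, haA, haS, hbA, hbS, p, hp⟩ := hI.conn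
      {u | u ∈ A ∧ ∀ e : G.edgeSet, u ∈ (e : Sym2 V) → e ∈ S}
      (by
        rintro u v huv ⟨hu, huS⟩
        have hv := hI.hA _ _ huv.symm
        refine ⟨hv, fun e he => hreach S hS v hv ⟨s(u, v), hI.le huv⟩ e (by simp) he ?_⟩
        exact huS _ (by simp))
      ⟨x, hxA, hxA, fun g hg => hreach S hS x hxA e g hxe hg heS⟩
      ⟨y, hyA, fun h => hfS (h.2 f hyf)⟩
    have hab : a ≠ b := by rintro rfl; exact hbS haS
    obtain ⟨e', f', he', hf', q, hq⟩ := walk_line j p hp hab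
    refine ⟨e', f', ⟨a, haA, he'⟩, haS.2 _ he', ⟨b, hbA, hf'⟩, fun hfS' => hbS ⟨hbA, ?_⟩, q, hq⟩
    exact fun g hg => hreach S hS b hbA f' g hf' hg hfS'
  · obtain ⟨e, f, g, h1, h2, h3⟩ := hI.tri
    have hne1 := h1.ne
    have hne2 := h2.ne
    have hne3 := h3.ne
    refine ⟨⟨s(e, f), h1⟩, ⟨s(f, g), h2⟩, ⟨s(e, g), h3⟩, ?_, ?_, ?_⟩
    · exact line_adj_of_mem (v := f) (by simp [Subtype.ext_iff] at *; grind) (by simp) (by simp)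
    · exact line_adj_of_mem (v := g) (by simp [Subtype.ext_iff] at *; grind) (by simp) (by simp)
    · exact line_adj_of_mem (v := e) (by simp [Subtype.ext_iff] at *; grind) (by simp) (by simp)

theorem main_induction (j : ℕ) : ∀ {V : Type} [Finite V] (G H : SimpleGraph V) (A : Set V),
    Inv G H A j → Traceable (iterLine ⟨V, G⟩ (j + 1)).2 := by
  induction j with
  | zero =>
    intro V _ G H A hI
    show Traceable G.lineGraph
    refine final_step G H A hI.le ?_ ?_ hI.odd ?_ ?_
    · intro v hv
      obtain ⟨z, hz⟩ := od_exists_adj hv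
      exact hI.hA _ _ hz
    · intro x hx y hy
      by_contra hxy
      obtain ⟨a, b, -, ha, -, hb, p, hp⟩ := hI.conn {z | H.Reachable x z}
        (fun u v huv hu => hu.trans huv.reachable) ⟨x, hx, Reachable.refl x⟩ ⟨y, hy, hxy⟩
      have := Walk.eq_of_length_eq_zero (Nat.le_zero.1 hp)
      exact hb (this ▸ ha)
    · intro u v huv
      by_contra! h
      exact hI.run u v ⟨h.1, h.2, huv⟩
    · obtain ⟨e, -⟩ := hI.tri
      exact ⟨e, e.2⟩
  | succ j ih =>
    intro V _ G H A hI
    obtain ⟨H', A', hI'⟩ := step hI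
    exact ih G.lineGraph H' A' hI'

/-! ### The initial stage -/

theorem run_seq {V : Type*} {G : SimpleGraph V} {A : Set V} (n : ℕ) : ∀ u v : V, Run G A n u v →
    ∃ f : ℕ → V, f 0 = u ∧ f 1 = v ∧ (∀ i ≤ n + 1, f i ∉ A) ∧
      (∀ i ≤ n, G.Adj (f i) (f (i + 1))) ∧ (∀ i < n, f (i + 2) ≠ f i) := by
  induction n with
  | zero =>
    rintro u v ⟨hu, hv, huv⟩
    refine ⟨fun i => if i = 0 then u else v, by simp, by simp, ?_, ?_, by simp⟩
    · intro i _
      by_cases h : i = 0 <;> simp [h, hu, hv]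
    · intro i hi
      obtain rfl : i = 0 := by omega
      simpa using huv
  | succ n ih =>
    rintro u v ⟨hu, huv, w, hwu, hr⟩
    obtain ⟨f, h0, h1, h2, h3, h4⟩ := ih v w hr
    refine ⟨fun i => Nat.casesOn i u f, rfl, h0, ?_, ?_, ?_⟩
    · rintro (_ | i) hi
      · exact hu
      · exact h2 i (by omega)
    · rintro (_ | i) hi
      · show G.Adj u (f 0)
        rwa [h0]
      · exact h3 i (by omega)
    · rintro (_ | i) hi
      · show f 1 ≠ u
        rwa [h1]
      · exact h4 i (by omega)

theorem no_run {V : Type*} [Finite V] {G : SimpleGraph V} (hG : G.Connected) {A : Set V} {j : ℕ}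
    (hidle : ∀ u, u ∉ A → ∀ a b c, G.Adj u a → G.Adj u b → G.Adj u c → a = b ∨ a = c ∨ b = c)
    (hA : A.Nonempty) (hcard : (Aᶜ).ncard ≤ j + 1) (u v : V) : ¬ Run G A j u v := by
  classical
  intro hr
  obtain ⟨f, -, -, h2, h3, h4⟩ := run_seq j u v hr
  have hex : ∃ k, k ≤ j + 1 ∧ ∃ i < k, f i = f k := by
    by_contra! hcon
    have hinj : Set.InjOn f (Set.Iic (j + 1)) := by
      intro x hx y hy hxy
      rcases lt_trichotomy x y with h | h | h
      · exact absurd hxy (hcon y hy x h)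
      · exact h
      · exact absurd hxy.symm (hcon x hx y h)
    have h5 := hinj.ncard_image
    have h6 : (f '' Set.Iic (j + 1)) ⊆ Aᶜ := by
      rintro _ ⟨i, hi, rfl⟩
      exact h2 i hi
    have h7 := Set.ncard_le_ncard h6
    have h8 : (Set.Iic (j + 1)).ncard = j + 2 := by
      rw [← Finset.coe_Iic, Set.ncard_coe_finset, Nat.card_Iic]
    omega
  obtain ⟨hk, i, hik, hfi⟩ := Nat.find_spec hex
  have hmin := fun m hm => Nat.find_min hex (m := m) hm
  generalize Nat.find hex = k at hk hik hfi hmin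
  have hne : ∀ x y, x < y → y < k → f x ≠ f y := by
    intro x y hxy hy h
    exact hmin y hy ⟨by omega, x, hxy, h⟩
  have hk1 : k ≠ i + 1 := by
    rintro rfl
    exact (h3 i (by omega)).ne hfi
  have hk2 : k ≠ i + 2 := by
    rintro rfl
    exact h4 i (by omega) hfi.symm
  have hclosed : ∀ x y, G.Adj x y → x ∈ f '' Set.Ico i k → y ∈ f '' Set.Ico i k := by
    rintro _ y hxy ⟨t, ⟨hit, htk⟩, rfl⟩
    rcases Nat.eq_or_lt_of_le hit with rfl | hlt
    · have e1 := h3 i (by omega)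
      have e2 := (h3 (k - 1) (by omega)).symm
      rw [show k - 1 + 1 = k by omega, ← hfi] at e2
      rcases hidle _ (h2 i (by omega)) _ _ _ hxy e1 e2 with h | h | h
      · exact ⟨i + 1, ⟨by omega, by omega⟩, h.symm⟩
      · exact ⟨k - 1, ⟨by omega, by omega⟩, h.symm⟩
      · exact absurd h (hne _ _ (by omega) (by omega))
    · have e1 := h3 t (by omega)
      have e2 := (h3 (t - 1) (by omega)).symm
      rw [show t - 1 + 1 = t by omega] at e2
      rcases hidle _ (h2 t (by omega)) _ _ _ hxy e1 e2 with h | h | h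
      · by_cases htk' : t + 1 = k
        · exact ⟨i, ⟨by omega, by omega⟩, by rw [h, htk', hfi]⟩
        · exact ⟨t + 1, ⟨by omega, by omega⟩, h.symm⟩
      · exact ⟨t - 1, ⟨by omega, by omega⟩, h.symm⟩
      · have := h4 (t - 1) (by omega)
        rw [show t - 1 + 2 = t + 1 by omega] at this
        exact absurd h this
  obtain ⟨a, ha⟩ := hA
  obtain ⟨p⟩ := hG.preconnected (f i) a
  have : a ∈ f '' Set.Ico i k := by
    by_contra hcon
    obtain ⟨d, -, hd1, hd2⟩ := p.exists_boundary_dart (f '' Set.Ico i k)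
      ⟨i, ⟨le_refl _, hik⟩, rfl⟩ hcon
    exact hd2 (hclosed _ _ d.adj hd1)
  obtain ⟨t, ⟨-, ht⟩, rfl⟩ := this
  exact h2 t (by omega) ha

theorem short_walk {V : Type*} [Finite V] {G : SimpleGraph V} (hG : G.Connected) {Q : Set V}
    {j : ℕ} (hQ : Q.Nonempty) (hcard : (Qᶜ).ncard ≤ j + 1) (hj : 1 ≤ j) {w : V} (hw : w ∉ Q)
    {x y z : V} (hx : G.Adj w x) (hy : G.Adj w y) (hz : G.Adj w z) (hxy : x ≠ y) (hyz : y ≠ z)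
    (hxz : x ≠ z) : ∃ p ∈ Q, ∃ q : G.Walk p w, q.length ≤ j := by
  obtain ⟨p, hp, hmin⟩ := Set.exists_min_image Q (fun p => G.dist p w) Q.toFinite hQ
  obtain ⟨q, hqP, hq⟩ := hG.exists_path_of_dist p w
  refine ⟨p, hp, q, ?_⟩
  by_contra! hlt
  have hoff : ∀ i, i ≤ q.length → q.getVert i ∈ Q → i = 0 := by
    intro i hi hiQ
    have h1 := hmin _ hiQ
    have h2 := dist_le (q.drop i)
    rw [Walk.drop_length] at h2
    omega
  have hinj : Set.InjOn q.getVert (Set.Icc 1 q.length) := by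
    intro a ha b hb hab
    exact hqP.getVert_injOn ha.2 hb.2 hab
  have hsub : q.getVert '' (Set.Icc 1 q.length) ⊆ Qᶜ := by
    rintro _ ⟨i, hi, rfl⟩ hiQ
    have := hoff i hi.2 hiQ
    have := hi.1
    omega
  have hc : (q.getVert '' (Set.Icc 1 q.length)).ncard = q.length := by
    rw [hinj.ncard_image, ← Finset.coe_Icc, Set.ncard_coe_finset, Nat.card_Icc]
    omega
  have heq : q.getVert '' (Set.Icc 1 q.length) = Qᶜ :=
    Set.eq_of_subset_of_ncard_le hsub (by omega)
  have key : ∀ x, G.Adj w x → x = q.getVert (q.length - 1) := by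
    intro x hx
    by_cases hxQ : x ∈ Q
    · have h1 := hmin x hxQ
      have h2 := dist_le (Walk.cons hx.symm Walk.nil)
      simp at h1 h2
      omega
    · have : x ∈ q.getVert '' (Set.Icc 1 q.length) := by rw [heq]; exact hxQ
      obtain ⟨i, hi, rfl⟩ := this
      have h1 := dist_le ((q.take i).concat hx.symm)
      rw [Walk.length_concat, Walk.take_length] at h1
      have h2 : i ≤ q.length := hi.2
      have h3 : i ≠ q.length := by
        rintro rfl
        rw [Walk.getVert_length] at hx
        exact hx.ne rfl
      congr 1
      omega
  exact hxy ((key x hx).trans (key y hy).symm)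

theorem main_aux {V : Type} [Finite V] (G : SimpleGraph V) (hG : G.Connected) {a b : V}
    (P : G.Walk a b) (hP : P.IsPath)
    (hmax : ∀ (u v : V) (q : G.Walk u v), q.IsPath → q.length ≤ P.length) (m : ℕ)
    (hm : {v | v ∈ P.support}ᶜ.ncard = m) (hm1 : 1 ≤ m) :
    Traceable (iterLine ⟨V, G⟩ m).2 := by
  classical
  let H : SimpleGraph V := fromEdgeSet {e | e ∈ P.edges}
  have hHadj : ∀ u v, H.Adj u v ↔ s(u, v) ∈ P.edges := by
    intro u v
    simp only [H, fromEdgeSet_adj, Set.mem_ofPred_eq, and_iff_left_iff_imp]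
    exact fun h => (P.adj_of_mem_edges h).ne
  have hle : H ≤ G := fun u v h => P.adj_of_mem_edges ((hHadj u v).1 h)
  have hHP : ∀ u v, H.Adj u v → u ∈ P.support := fun u v h =>
    P.fst_mem_support_of_mem_edges ((hHadj u v).1 h)
  have htr : ∀ e ∈ P.edges, e ∈ H.edgeSet := by
    intro e he
    induction e with | _ u v
    exact (hHadj u v).2 he
  have hodd : ∀ x, Od H x ↔ ¬ (x = a ↔ x = b) := by
    intro x
    have h1 := od_trail (P.transfer H htr) (hP.transfer htr).isTrail x
    have h2 : H.deleteEdges {e | e ∈ (P.transfer H htr).edges} = ⊥ := by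
      ext u v
      rw [Walk.edges_transfer]
      simp [hHadj]
    rw [h2] at h1
    have h3 : ¬ Od (⊥ : SimpleGraph V) x := by simp [Od]
    tauto
  have hncard : {v | Od H v}.ncard ≤ 2 := by
    have hsub : {v | Od H v} ⊆ {a, b} := by
      intro v hv
      have := (hodd v).1 hv
      simp only [Set.mem_insert_iff, Set.mem_singleton_iff]
      tauto
    exact (Set.ncard_le_ncard hsub).trans (by
      have := Set.ncard_insert_le a {b}
      simpa using this)
  have hreach : ∀ x ∈ P.support, H.Reachable a x := by
    intro x hx
    have : x ∈ (P.transfer H htr).support := by rwa [Walk.support_transfer]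
    exact ⟨(P.transfer H htr).takeUntil x this⟩
  -- an edge leaving the path
  obtain ⟨z0, hz0⟩ : ({v | v ∈ P.support}ᶜ).Nonempty :=
    Set.nonempty_of_ncard_ne_zero (by omega)
  obtain ⟨p0, z, hp0, hz, hp0z⟩ : ∃ p z, p ∈ P.support ∧ z ∉ P.support ∧ G.Adj p z := by
    obtain ⟨q⟩ := hG.preconnected a z0
    obtain ⟨d, -, h1, h2⟩ := q.exists_boundary_dart {v | v ∈ P.support} P.start_mem_support hz0
    exact ⟨_, _, h1, h2, d.adj⟩
  have hp0a : p0 ≠ a := by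
    rintro rfl
    have := hmax _ _ (Walk.cons hp0z.symm P) (by rw [Walk.cons_isPath_iff]; exact ⟨hP, hz⟩)
    simp at this
  have hp0b : p0 ≠ b := by
    rintro rfl
    have := hmax _ _ (Walk.cons hp0z.symm P.reverse)
      (by rw [Walk.cons_isPath_iff]; exact ⟨hP.reverse, by simpa using hz⟩)
    simp at this
  have hnb : ∀ x ∈ P.support, ∃ c, H.Adj x c := by
    intro x hx
    have : ∃ y, x ≠ y ∧ H.Reachable x y := by
      by_cases hxa : x = a
      · exact ⟨p0, by rw [hxa]; exact hp0a.symm, by rw [hxa]; exact hreach _ hp0⟩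
      · exact ⟨a, hxa, (hreach x hx).symm⟩
    obtain ⟨y, hxy, ⟨q⟩⟩ := this
    cases q with
    | nil => exact absurd rfl hxy
    | cons h q => exact ⟨_, h⟩
  obtain rfl | hm2 : m = 1 ∨ 2 ≤ m := by omega
  · show Traceable G.lineGraph
    refine final_step G H {v | v ∈ P.support} hle ?_ ?_ hncard ?_ ⟨s(p0, z), hp0z⟩
    · intro v hv
      obtain ⟨w, hw⟩ := od_exists_adj hv
      exact hHP _ _ hw
    · intro x hx y hy
      exact (hreach x hx).symm.trans (hreach y hy)
    · intro u v huv
      by_contra! hcon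
      exact huv.ne ((Set.ncard_le_one).1 hm.le u hcon.1 v hcon.2)
  obtain ⟨j, rfl⟩ : ∃ j, m = j + 1 := ⟨m - 1, by omega⟩
  let A : Set V := {v | v ∈ P.support ∨
    ∃ x y z, G.Adj v x ∧ G.Adj v y ∧ G.Adj v z ∧ x ≠ y ∧ y ≠ z ∧ x ≠ z}
  have hidle : ∀ u, u ∉ A → ∀ a b c, G.Adj u a → G.Adj u b → G.Adj u c →
      a = b ∨ a = c ∨ b = c := by
    intro u hu x y z hx hy hz
    by_contra! hcon
    exact hu (Or.inr ⟨x, y, z, hx, hy, hz, hcon.1, hcon.2.2, hcon.2.1⟩)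
  have hshort : ∀ w ∈ A, w ∉ P.support →
      ∃ p ∈ P.support, ∃ q : G.Walk p w, q.length ≤ j := by
    rintro w (hw | ⟨x, y, z, hx, hy, hz, h1, h2, h3⟩) hwP
    · exact absurd hw hwP
    · exact short_walk hG (Q := {v | v ∈ P.support}) ⟨a, P.start_mem_support⟩ hm.le (by omega)
        hwP hx hy hz h1 h2 h3
  refine main_induction j G H A ⟨hle, hncard, fun u v h => Or.inl (hHP u v h), hidle, ?_, ?_, ?_, ?_⟩
  · rintro u (hu | ⟨x, y, z, hx, hy, hz, h1, h2, h3⟩) c d hcd hc hd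
    · exact Or.inl (hnb u hu)
    · right
      by_cases hxc : x ≠ c ∧ x ≠ d
      · exact ⟨x, hxc.1, hxc.2, hx⟩
      by_cases hyc : y ≠ c ∧ y ≠ d
      · exact ⟨y, hyc.1, hyc.2, hy⟩
      refine ⟨z, ?_, ?_, hz⟩ <;> grind
  · refine no_run hG hidle ⟨a, Or.inl P.start_mem_support⟩ ?_
    rw [← hm]
    exact Set.ncard_le_ncard (Set.compl_subset_compl.2 (fun v hv => Or.inl hv))
  · rintro S hS ⟨x, hxA, hxS⟩ ⟨y, hyA, hyS⟩
    have hcl : ∀ T : Set V, (∀ u v, H.Adj u v → u ∈ T → v ∈ T) → ∀ u v, H.Reachable u v → u ∈ T →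
        v ∈ T := by
      rintro T hT u v ⟨q⟩ hu
      induction q with
      | nil => exact hu
      | cons h q ih => exact ih (hT _ _ h hu)
    by_cases haS : a ∈ S
    · have hPS : ∀ p ∈ P.support, p ∈ S := fun p hp => hcl S hS a p (hreach p hp) haS
      obtain ⟨p, hp, q, hq⟩ := hshort y hyA (fun h => hyS (hPS y h))
      exact ⟨p, y, Or.inl hp, hPS p hp, hyA, hyS, q, hq⟩
    · have hPS : ∀ p ∈ P.support, p ∉ S := fun p hp h =>
        haS (hcl S hS p a (hreach p hp).symm h)
      obtain ⟨p, hp, q, hq⟩ := hshort x hxA (fun h => hPS x h hxS)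
      exact ⟨x, p, hxA, hxS, Or.inl hp, hPS p hp, q.reverse, by simpa using hq⟩
  · have hno : ¬ Od H p0 := by
      rw [hodd]
      tauto
    obtain ⟨c, hc⟩ := hnb p0 hp0
    have h1 : 1 < (H.neighborSet p0).ncard := by
      have h2 : (H.neighborSet p0).ncard ≠ 0 := by
        exact ((Set.ncard_pos (Set.toFinite _)).2 ⟨c, hc⟩).ne'
      have h3 : (H.neighborSet p0).ncard ≠ 1 := by
        intro h
        exact hno (by unfold Od; rw [h]; exact odd_one)
      omega
    obtain ⟨x, hx, y, hy, hxy⟩ := (Set.one_lt_ncard).1 h1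
    have hxP := hHP _ _ (H.adj_symm hx)
    have hyP := hHP _ _ (H.adj_symm hy)
    have hxz : x ≠ z := by rintro rfl; exact hz hxP
    have hyz : y ≠ z := by rintro rfl; exact hz hyP
    have hne : ∀ u v (hu : G.Adj p0 u) (hv : G.Adj p0 v), u ≠ v →
        G.lineGraph.Adj ⟨s(p0, u), hu⟩ ⟨s(p0, v), hv⟩ := by
      intro u v hu hv huv
      refine line_adj_of_mem (v := p0) ?_ (by simp) (by simp)
      intro h
      exact huv (Sym2.congr_right.1 (Subtype.ext_iff.1 h))
    exact ⟨⟨s(p0, x), hle hx⟩, ⟨s(p0, y), hle hy⟩, ⟨s(p0, z), hp0z⟩, hne _ _ _ _ hxy,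
      hne _ _ _ _ hyz, hne _ _ _ _ hxz⟩

/-- `h_p(G) ≤ max {1, n - diam(G) - 1}`. -/
theorem stmt13 {V : Type} [Fintype V] (G : SimpleGraph V) (hG : G.Connected) :
    hp G ≤ max 1 (Fintype.card V - G.diam - 1) := by
  classical
  have := hG.nonempty
  obtain ⟨a, b, P, hP, hmax⟩ := Walk.exists_isPath_forall_isPath_length_le_length G
  by_cases hall : ∀ w, w ∈ P.support
  · have h0 : hp G ≤ 0 := Nat.sInf_le ⟨a, b, P, hP, hall⟩
    omega
  have hcard : {v | v ∈ P.support}.ncard = P.length + 1 := by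
    have h1 : {v | v ∈ P.support} = (P.support.toFinset : Set V) := by ext; simp
    rw [h1, Set.ncard_coe_finset, List.toFinset_card_of_nodup hP.support_nodup,
      Walk.length_support]
  have hcompl := Set.ncard_add_ncard_compl {v | v ∈ P.support}
  rw [Nat.card_eq_fintype_card, hcard] at hcompl
  have hpos : 1 ≤ ({v | v ∈ P.support}ᶜ).ncard := by
    push Not at hall
    exact (Set.ncard_pos (Set.toFinite _)).2 hall
  have hle : hp G ≤ ({v | v ∈ P.support}ᶜ).ncard :=
    Nat.sInf_le (main_aux G hG P hP (fun u v q hq => hmax u v q hq) _ rfl hpos)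
  obtain ⟨u, v, huv⟩ := G.exists_dist_eq_diam
  obtain ⟨q, hq, hql⟩ := hG.exists_path_of_dist u v
  have := hmax u v q hq
  omega
end Paper
end

section
/- Let G be a connected simple graph of order n. Then h_p(G) ≤ ⌊(n − Δ(G))/3⌋ + 3, where Δ(G) is the maximum degree of G. -/
open SimpleGraph

namespace Paper

/-- Turn a duplicate-free chain into a path whose edges satisfy a symmetric relation. -/
theorem path_of_list {α : Type*} (H : SimpleGraph α) (R : α → α → Prop)
    (hR : ∀ a b, R a b → R b a) (hA : ∀ a b, a ≠ b → R a b → H.Adj a b) :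
    ∀ (l : List α) (a : α), (a :: l).Nodup →
      (a :: l).IsChain R →
      ∃ (b : α) (p : H.Walk a b), p.IsPath ∧ p.support = a :: l ∧
        ∀ x y, s(x, y) ∈ p.edges → R x y := by
  intro l
  induction l with
  | nil =>
    intro a _ _
    exact ⟨a, Walk.nil, by simp, by simp, by simp⟩
  | cons c l ih =>
    intro a hn hc
    rw [List.isChain_cons_cons] at hc
    obtain ⟨b, p, hp, hs, he⟩ := ih c (List.nodup_cons.1 hn).2 hc.2
    refine ⟨b, Walk.cons (hA _ _ (by rintro rfl; simp at hn) hc.1) p, ?_, by simp [hs], ?_⟩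
    · rw [Walk.cons_isPath_iff]
      refine ⟨hp, ?_⟩
      rw [hs]
      exact (List.nodup_cons.1 hn).1
    · intro x y hxy
      rw [Walk.edges_cons, List.mem_cons] at hxy
      rcases hxy with h | h
      · rcases Sym2.eq_iff.1 h with ⟨rfl, rfl⟩ | ⟨rfl, rfl⟩
        · exact hc.1
        · exact hR _ _ hc.1
      · exact he _ _ h

open Classical in
/-- The edges touching a trail can be listed so that consecutive ones meet on the trail. -/
theorem trail_list {V : Type*} [Finite V] (G : SimpleGraph V) {u v : V} (T : G.Walk u v) :
    T.IsTrail → ∀ F : Set G.edgeSet, (∀ e ∈ F, e.1 ∉ T.edges) →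
    ∃ l : List G.edgeSet, l.Nodup ∧
      l.IsChain (fun e f => ∃ a ∈ T.support, a ∈ e.1 ∧ a ∈ f.1) ∧
      (∀ e, e ∈ l ↔ (∃ a ∈ T.support, a ∈ e.1) ∧ e ∉ F) ∧
      (∀ x ∈ l.head?, u ∈ x.1) := by
  have : Fintype G.edgeSet := Fintype.ofFinite _
  induction T with
  | nil =>
    rename_i u
    intro _ F _
    have hm : ∀ e : G.edgeSet,
        e ∈ (Finset.univ.filter (fun e : G.edgeSet => u ∈ e.1 ∧ e ∉ F)).toList ↔
          (u ∈ e.1 ∧ e ∉ F) := by intro e; simp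
    refine ⟨(Finset.univ.filter (fun e : G.edgeSet => u ∈ e.1 ∧ e ∉ F)).toList,
      Finset.nodup_toList _, ?_, ?_, ?_⟩
    · apply List.Pairwise.isChain
      apply List.pairwise_of_forall_mem_list
      intro a ha b hb
      exact ⟨u, by simp, ((hm a).1 ha).1, ((hm b).1 hb).1⟩
    · intro e
      rw [hm]; simp
    · intro x hx
      exact ((hm x).1 (List.mem_of_mem_head? hx)).1
  | cons h T ih =>
    rename_i u w v
    intro hT F hF
    rw [Walk.isTrail_cons] at hT
    obtain ⟨l, hn, hc, hmem, hh⟩ := ih hT.1 (F ∪ {e | u ∈ e.1 ∧ e.1 ∉ T.edges}) (by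
      rintro e (he | he) h'
      · exact hF e he (by simp [h'])
      · exact he.2 h')
    set e0 : G.edgeSet := ⟨s(u, w), h⟩ with he0
    have hm : ∀ e : G.edgeSet,
        e ∈ (Finset.univ.filter (fun e : G.edgeSet => u ∈ e.1 ∧ e ∉ F ∧ e ≠ e0 ∧
          e.1 ∉ T.edges)).toList ↔
          (u ∈ e.1 ∧ e ∉ F ∧ e ≠ e0 ∧ e.1 ∉ T.edges) := by intro e; simp
    set B := (Finset.univ.filter (fun e : G.edgeSet => u ∈ e.1 ∧ e ∉ F ∧ e ≠ e0 ∧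
          e.1 ∉ T.edges)).toList with hB
    have he0F : e0 ∉ F := fun h' => hF e0 h' (by simp [he0])
    have hue0 : u ∈ e0.1 := by simp [he0]
    have hwe0 : w ∈ e0.1 := by simp [he0]
    have he0l : e0 ∉ l := by
      intro h'
      exact ((hmem e0).1 h').2 (Or.inr ⟨hue0, hT.2⟩)
    refine ⟨B ++ e0 :: l, ?_, ?_, ?_, ?_⟩
    · rw [List.nodup_append]
      refine ⟨Finset.nodup_toList _, List.nodup_cons.2 ⟨he0l, hn⟩, ?_⟩
      intro a ha b hb hab
      subst hab
      rw [hm] at ha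
      rcases List.mem_cons.1 hb with h' | h'
      · exact ha.2.2.1 h'
      · exact ((hmem a).1 h').2 (Or.inr ⟨ha.1, ha.2.2.2⟩)
    · rw [List.isChain_append]
      refine ⟨?_, ?_, ?_⟩
      · apply List.Pairwise.isChain
        apply List.pairwise_of_forall_mem_list
        intro a ha b hb
        exact ⟨u, by simp, ((hm a).1 ha).1, ((hm b).1 hb).1⟩
      · rw [List.isChain_cons]
        refine ⟨?_, ?_⟩
        · intro y hy
          exact ⟨w, by simp, hwe0, hh y hy⟩
        · refine hc.imp ?_
          rintro a b ⟨x, hx, hx2⟩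
          exact ⟨x, by simp [hx], hx2⟩
      · intro x hx y hy
        have hx' := List.mem_of_getLast? hx
        simp only [List.head?_cons, Option.mem_def, Option.some.injEq] at hy
        subst hy
        exact ⟨u, by simp, ((hm x).1 hx').1, hue0⟩
    · intro e
      rw [List.mem_append, List.mem_cons, hm, hmem]
      constructor
      · rintro (h' | h' | h')
        · exact ⟨⟨u, by simp, h'.1⟩, h'.2.1⟩
        · subst h'
          exact ⟨⟨u, by simp, hue0⟩, he0F⟩
        · obtain ⟨⟨a, ha, ha2⟩, h2⟩ := h'
          exact ⟨⟨a, by simp [ha], ha2⟩, fun hf => h2 (Or.inl hf)⟩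
      · rintro ⟨⟨a, ha, ha2⟩, h2⟩
        by_cases hu : u ∈ e.1
        · by_cases hT' : e.1 ∈ T.edges
          · right; right
            refine ⟨⟨u, ?_, hu⟩, ?_⟩
            · obtain ⟨z, hz⟩ := Sym2.mem_iff_exists.1 hu
              rw [hz] at hT'
              exact T.fst_mem_support_of_mem_edges hT'
            · rintro (hf | hf)
              · exact h2 hf
              · exact hf.2 hT'
          · by_cases hee : e = e0
            · right; left; exact hee
            · left; exact ⟨hu, h2, hee, hT'⟩
        · right; right
          rw [Walk.support_cons, List.mem_cons] at ha
          rcases ha with rfl | ha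
          · exact absurd ha2 hu
          · exact ⟨⟨a, ha, ha2⟩, by rintro (hf | hf); exacts [h2 hf, hu hf.1]⟩
    · intro x hx
      cases hBB : B with
      | nil =>
        rw [hBB] at hx
        simp only [List.nil_append, List.head?_cons, Option.mem_def, Option.some.injEq] at hx
        subst hx; exact hue0
      | cons b B' =>
        rw [hBB] at hx
        simp only [List.cons_append, List.head?_cons, Option.mem_def, Option.some.injEq] at hx
        subst hx
        exact ((hm b).1 (by rw [hBB]; simp)).1

/-- A trail in `G` touching an edge yields a path in the line graph through all touched edges. -/
theorem line_path {V : Type*} [Finite V] (G : SimpleGraph V) {u v : V} (T : G.Walk u v)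
    (hT : T.IsTrail) (hne : ∃ e : G.edgeSet, ∃ a ∈ T.support, a ∈ e.1) :
    ∃ (e f : G.edgeSet) (p : G.lineGraph.Walk e f), p.IsPath ∧
      (∀ e, (∃ a ∈ T.support, a ∈ e.1) → e ∈ p.support) ∧
      (∀ x y, s(x, y) ∈ p.edges → ∃ a ∈ T.support, a ∈ x.1 ∧ a ∈ y.1) := by
  obtain ⟨l, hn, hc, hm, -⟩ := trail_list G T hT ∅ (by simp)
  cases l with
  | nil =>
    obtain ⟨e, he⟩ := hne
    exact absurd ((hm e).2 ⟨he, by simp⟩) (by simp)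
  | cons e l =>
    obtain ⟨f, p, hp, hs, hR⟩ := path_of_list G.lineGraph
      (fun e f => ∃ a ∈ T.support, a ∈ e.1 ∧ a ∈ f.1)
      (fun a b ⟨x, hx, h1, h2⟩ => ⟨x, hx, h2, h1⟩)
      (fun a b hab ⟨x, hx, h1, h2⟩ => lineGraph_adj_iff_exists.2 ⟨hab, x, h1, h2⟩) l e hn hc
    refine ⟨e, f, p, hp, ?_, hR⟩
    intro g hg
    rw [hs]
    exact (hm g).2 ⟨hg, by simp⟩

/-- Closing a path through an outside vertex gives a closed trail. -/
theorem loop_trail {V : Type*} {G : SimpleGraph V} {a b c : V} (q : G.Walk a b)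
    (hq : q.IsPath) (hab : a ≠ b) (hc : c ∉ q.support) (h1 : G.Adj c a) (h2 : G.Adj b c) :
    (Walk.cons h1 (q.concat h2)).IsTrail := by
  have hb : s(b, c) ∉ q.edges := fun h => hc (q.snd_mem_support_of_mem_edges h)
  have ha : s(c, a) ∉ q.edges := fun h => hc (q.fst_mem_support_of_mem_edges h)
  rw [Walk.isTrail_cons]
  constructor
  · rw [Walk.concat_eq_append, Walk.isTrail_append]
    refine ⟨hq.isTrail, by simp, ?_⟩
    simpa using hb
  · rw [Walk.edges_concat]
    simp only [List.concat_eq_append, List.mem_append, List.mem_singleton, not_or]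
    refine ⟨ha, ?_⟩
    rw [Sym2.eq_iff]
    rintro (⟨h, -⟩ | ⟨-, h⟩)
    · exact h2.ne h.symm
    · exact hab h

open Classical in
/-- Splicing a closed trail into a trail. -/
theorem splice {V : Type*} {G : SimpleGraph V} {a b c : V} (T : G.Walk a b) (hT : T.IsTrail)
    (hc : c ∈ T.support) (C : G.Walk c c) (hC : C.IsTrail)
    (hd : ∀ e ∈ C.edges, e ∉ T.edges) :
    ∃ T' : G.Walk a b, T'.IsTrail ∧ (∀ x, x ∈ T'.support ↔ x ∈ T.support ∨ x ∈ C.support) ∧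
      (∀ e, e ∈ T'.edges ↔ e ∈ T.edges ∨ e ∈ C.edges) := by
  have hsp := T.take_spec hc
  have hT0 := hT
  rw [← hsp, Walk.isTrail_append] at hT
  have hs : ∀ x, x ∈ T.support ↔ x ∈ (T.takeUntil c hc).support ∨
      x ∈ (T.dropUntil c hc).support := by
    intro x; rw [← Walk.mem_support_append_iff, hsp]
  have he : ∀ x, x ∈ T.edges ↔ x ∈ (T.takeUntil c hc).edges ∨
      x ∈ (T.dropUntil c hc).edges := by
    intro x; rw [← List.mem_append, ← Walk.edges_append, hsp]
  refine ⟨((T.takeUntil c hc).append C).append (T.dropUntil c hc), ?_, ?_, ?_⟩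
  · rw [Walk.isTrail_append, Walk.isTrail_append]
    refine ⟨⟨hT.1, hC, ?_⟩, hT.2.1, ?_⟩
    · intro x hx hx2
      exact hd x hx2 ((he x).2 (Or.inl hx))
    · intro x hx hx2
      rw [Walk.edges_append, List.mem_append] at hx
      rcases hx with hx | hx
      · exact hT.2.2 hx hx2
      · exact hd x hx ((he x).2 (Or.inr hx2))
  · intro x
    rw [Walk.mem_support_append_iff, Walk.mem_support_append_iff, hs]; tauto
  · intro x
    rw [Walk.edges_append, Walk.edges_append, List.mem_append, List.mem_append, he]; tauto

/-- The line graph of a connected graph is preconnected. -/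
theorem line_reach {V : Type*} {G : SimpleGraph V} {u v : V} (p : G.Walk u v) :
    ∀ e f : G.edgeSet, u ∈ e.1 → v ∈ f.1 → G.lineGraph.Reachable e f := by
  have key : ∀ (x : V) (e f : G.edgeSet), x ∈ e.1 → x ∈ f.1 → G.lineGraph.Reachable e f := by
    intro x e f he hf
    by_cases h : e = f
    · rw [h]
    · exact (lineGraph_adj_iff_exists.2 ⟨h, x, he, hf⟩).reachable
  induction p with
  | nil => intro e f he hf; exact key _ e f he hf
  | cons h p ih =>
    intro e f he hf
    exact (key _ e ⟨s(_, _), h⟩ he (by simp)).trans (ih ⟨s(_, _), h⟩ f (by simp) hf)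

theorem line_connected {V : Type*} {G : SimpleGraph V} (hG : G.Connected)
    (e0 : G.edgeSet) : G.lineGraph.Connected := by
  have : Nonempty G.edgeSet := ⟨e0⟩
  refine ⟨?_⟩
  rintro ⟨e, he⟩ ⟨f, hf⟩
  induction e with
  | h a b =>
    induction f with
    | h c d =>
      obtain ⟨p⟩ := hG.preconnected a c
      exact line_reach p _ _ (by simp) (by simp)
/-- An (locally induced) run of `s` vertices avoiding `S` whose only neighbours are on the run. -/
def BadRun {V : Type*} (G : SimpleGraph V) (S : Set V) (s : ℕ) (x : ℕ → V) : Prop :=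
  (∀ i ≤ s, G.Adj (x i) (x (i + 1))) ∧
  ∀ i < s, x i ≠ x (i + 2) ∧ ¬ G.Adj (x i) (x (i + 2)) ∧ x (i + 1) ∉ S ∧
    ∀ u, G.Adj (x (i + 1)) u → u = x i ∨ u = x (i + 2)

theorem exists_rep {V : Type*} (s : ℕ) (e : ℕ → Sym2 V)
    (h1 : ∀ i ≤ s, ∃ v, v ∈ e i ∧ v ∈ e (i + 1))
    (h2 : ∀ i < s, ∀ v, v ∈ e i → v ∈ e (i + 2) → False) :
    ∃ x : ℕ → V, ∀ i ≤ s + 1, e i = s(x i, x (i + 1)) := by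
  have h1' : ∀ i, ∃ v, i ≤ s → v ∈ e i ∧ v ∈ e (i + 1) := by
    intro i
    by_cases hi : i ≤ s
    · obtain ⟨v, hv⟩ := h1 i hi; exact ⟨v, fun _ => hv⟩
    · obtain ⟨v, hv⟩ := h1 0 (by omega); exact ⟨v, fun h => absurd h hi⟩
  choose y hy using h1'
  obtain ⟨z0, hz0⟩ := Sym2.mem_iff_exists.1 (hy 0 (by omega)).1
  obtain ⟨z1, hz1⟩ := Sym2.mem_iff_exists.1 (hy s le_rfl).2
  refine ⟨fun i => if i = 0 then z0 else if i ≤ s + 1 then y (i - 1) else z1, ?_⟩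
  intro i hi
  rcases Nat.eq_zero_or_pos i with rfl | hpos
  · simp only [hz0, if_true, Nat.zero_add, Nat.one_ne_zero, if_false,
      show 1 ≤ s + 1 by omega, Nat.sub_self]
    exact Sym2.eq_swap
  · obtain ⟨j, rfl⟩ : ∃ j, i = j + 1 := ⟨i - 1, by omega⟩
    by_cases hj : j = s
    · subst hj
      simp [hz1]
    · have hjs : j < s := by omega
      have hne : y j ≠ y (j + 1) := by
        intro h
        exact h2 j hjs (y j) (hy j (by omega)).1 (h ▸ (hy (j + 1) (by omega)).2)
      simp only [Nat.add_eq_zero_iff, Nat.one_ne_zero, and_false, if_false, hi, if_true,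
        Nat.add_sub_cancel, show j + 1 + 1 ≤ s + 1 by omega]
      exact (Sym2.mem_and_mem_iff hne).1 ⟨(hy j (by omega)).2, (hy (j + 1) (by omega)).1⟩

/-- Bad runs of the line graph come from longer bad runs of the graph. -/
theorem badRun_line {V : Type*} {G : SimpleGraph V} {S : Set V} {S' : Set G.edgeSet}
    (hS : ∀ f : G.edgeSet, (∃ a ∈ S, a ∈ f.1) → f ∈ S') {s : ℕ} (hs : 1 ≤ s)
    {e : ℕ → G.edgeSet} (he : BadRun G.lineGraph S' s e) :
    ∃ x, BadRun G S (s + 1) x := by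
  obtain ⟨ha, hb⟩ := he
  have hD : ∀ i < s, ∀ v, v ∈ (e i).1 → v ∈ (e (i + 2)).1 → False := by
    intro i hi v h1 h2
    exact (hb i hi).2.1 (lineGraph_adj_iff_exists.2 ⟨(hb i hi).1, v, h1, h2⟩)
  obtain ⟨x, hx⟩ := exists_rep s (fun i => (e i).1)
    (fun i hi => (lineGraph_adj_iff_exists.1 (ha i hi)).2) hD
  have hl : ∀ i ≤ s + 1, x i ∈ (e i).1 := fun i hi => by rw [hx i hi]; simp
  have hr : ∀ i ≤ s + 1, x (i + 1) ∈ (e i).1 := fun i hi => by rw [hx i hi]; simp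
  have hadj : ∀ i ≤ s + 1, G.Adj (x i) (x (i + 1)) := by
    intro i hi
    have := (e i).2
    rw [hx i hi] at this
    exact this
  have hnb : ∀ i ≤ s, ∀ u, G.Adj (x (i + 1)) u → u = x i ∨ u = x (i + 2) := by
    intro i hi u hu
    set g : G.edgeSet := ⟨s(x (i + 1), u), hu⟩ with hg
    have hxg : x (i + 1) ∈ g.1 := by simp [hg]
    have k0 : g = e i → u = x i := by
      intro h
      have h' : s(x (i + 1), u) = s(x i, x (i + 1)) := by rw [← hx i (by omega), ← h]
      rcases Sym2.eq_iff.1 h' with ⟨h1, h2⟩ | ⟨h1, h2⟩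
      · exact absurd h1.symm (hadj i (by omega)).ne
      · exact h2
    have k1 : g = e (i + 1) → u = x (i + 2) := by
      intro h
      have h' : s(x (i + 1), u) = s(x (i + 1), x (i + 2)) := by
        rw [← hx (i + 1) (by omega), ← h]
      rcases Sym2.eq_iff.1 h' with ⟨h1, h2⟩ | ⟨h1, h2⟩
      · exact h2
      · exact absurd h1 (hadj (i + 1) (by omega)).ne
    rcases Nat.eq_zero_or_pos i with rfl | hpos
    · by_cases h : g = e 1
      · exact Or.inr (k1 h)
      · have : G.lineGraph.Adj (e (0 + 1)) g :=
          lineGraph_adj_iff_exists.2 ⟨Ne.symm h, x 1, hl 1 (by omega), hxg⟩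
        rcases (hb 0 (by omega)).2.2.2 g this with h' | h'
        · exact Or.inl (k0 h')
        · exact (hD 0 (by omega) (x 1) (hr 0 (by omega)) (h' ▸ hxg)).elim
    · obtain ⟨j, rfl⟩ : ∃ j, i = j + 1 := ⟨i - 1, by omega⟩
      by_cases h : g = e (j + 1)
      · exact Or.inl (k0 h)
      · have : G.lineGraph.Adj (e (j + 1)) g :=
          lineGraph_adj_iff_exists.2 ⟨Ne.symm h, x (j + 2), hr (j + 1) (by omega), hxg⟩
        rcases (hb j (by omega)).2.2.2 g this with h' | h'
        · exact (hD j (by omega) (x (j + 2)) (h' ▸ hxg) (hl (j + 2) (by omega))).elim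
        · exact Or.inr (k1 h')
  refine ⟨x, fun i hi => hadj i hi, ?_⟩
  intro i hi
  refine ⟨?_, ?_, ?_, hnb i (by omega)⟩
  · intro h
    have h1 := hx i (by omega)
    have h2 := hx (i + 1) (by omega)
    rw [h, Sym2.eq_swap] at h1
    have : e i = e (i + 1) := Subtype.ext (h1.trans h2.symm)
    exact (ha i (by omega)).ne this
  · intro h
    by_cases his : i < s
    · rcases hnb (i + 1) (by omega) (x i) h.symm with h' | h'
      · exact (hadj i (by omega)).ne h'
      · exact hD i his (x i) (hl i (by omega)) (h' ▸ hr (i + 2) (by omega))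
    · obtain ⟨j, rfl⟩ : ∃ j, i = j + 1 := ⟨i - 1, by omega⟩
      rcases hnb j (by omega) _ h with h' | h'
      · exact hD j (by omega) (x j) (hl j (by omega)) (h' ▸ hr (j + 2) (by omega))
      · exact (hadj (j + 2) (by omega)).ne h'.symm
  · intro h
    rcases Nat.eq_zero_or_pos i with rfl | hpos
    · exact (hb 0 (by omega)).2.2.1 (hS _ ⟨_, h, hl 1 (by omega)⟩)
    · obtain ⟨j, rfl⟩ : ∃ j, i = j + 1 := ⟨i - 1, by omega⟩
      exact (hb j (by omega)).2.2.1 (hS _ ⟨_, h, hr (j + 1) (by omega)⟩)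

/-- `A` is covered by a trail of the line graph using only edges located at `A`. -/
def Cov {V : Type*} (G : SimpleGraph V) (A : Set V) : Prop :=
  ∃ (a b : G.edgeSet) (T : G.lineGraph.Walk a b), T.IsTrail ∧
    (∀ e : G.edgeSet, (∃ v ∈ A, v ∈ e.1) → e ∈ T.support) ∧
    (∀ e f, s(e, f) ∈ T.edges → ∃ v ∈ A, v ∈ e.1 ∧ v ∈ f.1)

/-- At least three neighbours. -/
def Big {V : Type*} (G : SimpleGraph V) (u : V) : Prop :=
  ∃ a b c, a ≠ b ∧ a ≠ c ∧ b ≠ c ∧ G.Adj u a ∧ G.Adj u b ∧ G.Adj u c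

open Classical in
theorem cov_insert {V : Type*} [Finite V] {G : SimpleGraph V} {A : Set V} (hA : Cov G A)
    {x u : V} (hx : x ∈ A) (hu : u ∉ A) (hxu : G.Adj x u) (hbig : Big G u) :
    Cov G (insert u A) := by
  have : Fintype G.edgeSet := Fintype.ofFinite _
  obtain ⟨a, b, T, hT, hcov, hed⟩ := hA
  set e0 : G.edgeSet := ⟨s(x, u), hxu⟩ with he0
  have hue0 : u ∈ e0.1 := by simp [he0]
  have hxe0 : x ∈ e0.1 := by simp [he0]
  have hm : ∀ e : G.edgeSet,
      e ∈ (Finset.univ.filter (fun e : G.edgeSet => u ∈ e.1 ∧ e ≠ e0)).toList ↔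
        (u ∈ e.1 ∧ e ≠ e0) := by intro e; simp
  have hnd := Finset.nodup_toList (Finset.univ.filter (fun e : G.edgeSet => u ∈ e.1 ∧ e ≠ e0))
  set l := (Finset.univ.filter (fun e : G.edgeSet => u ∈ e.1 ∧ e ≠ e0)).toList with hl
  -- two further edges
  have htwo : ∃ y z, y ≠ z ∧ y ≠ x ∧ z ≠ x ∧ G.Adj u y ∧ G.Adj u z := by
    obtain ⟨p, q, r, h1, h2, h3, h4, h5, h6⟩ := hbig
    by_cases hp : p = x
    · subst hp; exact ⟨q, r, h3, h1.symm, h2.symm, h5, h6⟩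
    · by_cases hq : q = x
      · subst hq; exact ⟨p, r, h2, h1, h3.symm, h4, h6⟩
      · exact ⟨p, q, h1, hp, hq, h4, h5⟩
  obtain ⟨y, z, hyz, hyx, hzx, hy, hz⟩ := htwo
  have hmem : ∀ y (hy : G.Adj u y), y ≠ x → (⟨s(u, y), hy⟩ : G.edgeSet) ∈ l := by
    intro y hy hyx
    rw [hm]
    refine ⟨by simp, ?_⟩
    intro h
    have h' : s(u, y) = s(x, u) := congrArg Subtype.val h
    rcases Sym2.eq_iff.1 h' with ⟨h1, h2⟩ | ⟨h1, h2⟩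
    · exact hxu.ne h1.symm
    · exact hyx h2
  have hyl := hmem y hy hyx
  have hzl := hmem z hz hzx
  have hyzne : (⟨s(u, y), hy⟩ : G.edgeSet) ≠ ⟨s(u, z), hz⟩ := by
    intro h
    have h' : s(u, y) = s(u, z) := congrArg Subtype.val h
    rcases Sym2.eq_iff.1 h' with ⟨h1, h2⟩ | ⟨h1, h2⟩
    · exact hyz h2
    · exact hz.ne h1
  cases hll : l with
  | nil => rw [hll] at hyl; simp at hyl
  | cons f l' =>
    have hpair : ∀ p q : G.edgeSet, p ≠ q → (u ∈ p.1 ∧ u ∈ q.1) → G.lineGraph.Adj p q :=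
      fun p q h h' => lineGraph_adj_iff_exists.2 ⟨h, u, h'.1, h'.2⟩
    have hmu : ∀ p ∈ l, u ∈ p.1 := fun p hp => ((hm p).1 hp).1
    obtain ⟨g, q, hq, hqs, -⟩ := path_of_list G.lineGraph (fun p q => u ∈ p.1 ∧ u ∈ q.1)
      (fun _ _ h => ⟨h.2, h.1⟩) hpair l' f (hll ▸ hnd) (by
        apply List.Pairwise.isChain
        apply List.pairwise_of_forall_mem_list
        intro p hp r hr
        exact ⟨hmu p (hll ▸ hp), hmu r (hll ▸ hr)⟩)
    rw [← hll] at hqs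
    have hfl : f ∈ l := by rw [hll]; simp
    have hgl : g ∈ l := by rw [← hqs]; exact q.end_mem_support
    have hfg : f ≠ g := by
      rintro rfl
      have hq0 : q = Walk.nil := (Walk.isPath_iff_nil.1 hq).eq_nil
      rw [hq0, Walk.support_nil] at hqs
      rw [← hqs, List.mem_singleton] at hyl hzl
      exact hyzne (hyl.trans hzl.symm)
    have he0l : e0 ∉ q.support := by rw [hqs, hm]; simp
    have hloop := loop_trail q hq hfg he0l
      (hpair _ _ (Ne.symm ((hm f).1 hfl).2) ⟨hue0, hmu f hfl⟩)
      (hpair _ _ ((hm g).1 hgl).2 ⟨hmu g hgl, hue0⟩)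
    set C := Walk.cons (hpair _ _ (Ne.symm ((hm f).1 hfl).2) ⟨hue0, hmu f hfl⟩)
      (q.concat (hpair _ _ ((hm g).1 hgl).2 ⟨hmu g hgl, hue0⟩)) with hC
    have hCs : ∀ p, p ∈ C.support ↔ u ∈ p.1 := by
      intro p
      rw [hC, Walk.support_cons, Walk.support_concat, hqs]
      simp only [List.concat_eq_append, List.mem_cons, List.mem_append, hm, List.not_mem_nil,
        or_false]
      constructor
      · rintro (rfl | h | rfl)
        exacts [hue0, h.1, hue0]
      · intro h
        by_cases hp : p = e0
        · exact Or.inl hp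
        · exact Or.inr (Or.inl ⟨h, hp⟩)
    have hCe : ∀ p r, s(p, r) ∈ C.edges → p ≠ r ∧ u ∈ p.1 ∧ u ∈ r.1 := by
      intro p r h
      exact ⟨(C.adj_of_mem_edges h).ne, (hCs p).1 (C.fst_mem_support_of_mem_edges h),
        (hCs r).1 (C.snd_mem_support_of_mem_edges h)⟩
    obtain ⟨T', hT', hs', he'⟩ := splice T hT (hcov e0 ⟨x, hx, hxe0⟩) C hloop (by
      intro e
      induction e with
      | h p r =>
        intro h1 h2
        obtain ⟨k1, k2, k3⟩ := hCe p r h1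
        obtain ⟨v, hv, k4, k5⟩ := hed p r h2
        have hne : u ≠ v := by rintro rfl; exact hu hv
        exact k1 (Subtype.ext (((Sym2.mem_and_mem_iff hne).1 ⟨k2, k4⟩).trans
          ((Sym2.mem_and_mem_iff hne).1 ⟨k3, k5⟩).symm)))
    refine ⟨a, b, T', hT', ?_, ?_⟩
    · rintro e ⟨v, hv | hv, hve⟩
      · subst hv; exact (hs' e).2 (Or.inr ((hCs e).2 hve))
      · exact (hs' e).2 (Or.inl (hcov e ⟨v, hv, hve⟩))
    · intro e f hef
      rcases (he' _).1 hef with h | h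
      · obtain ⟨v, hv, h2⟩ := hed e f h
        exact ⟨v, Or.inr hv, h2⟩
      · exact ⟨u, Or.inl rfl, (hCe e f h).2⟩

theorem cov_all {V : Type*} [Finite V] {G : SimpleGraph V} (hG : G.Connected) {u v : V}
    (P : G.Walk u v) (hP : P.IsTrail) (hne : ∃ e : G.edgeSet, ∃ a ∈ P.support, a ∈ e.1)
    (hbad : ∀ x, ¬ BadRun G {w | w ∈ P.support} 1 x) :
    ∃ A : Set V, Cov G A ∧ (∀ w ∈ P.support, w ∈ A) ∧ ∀ w, Big G w → w ∈ A := by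
  obtain ⟨e, f, p, hp, hp1, hp2⟩ := line_path G P hP hne
  have h0 : Cov G {w | w ∈ P.support} := ⟨e, f, p, hp.isTrail, hp1, hp2⟩
  obtain ⟨A, hPA, hmax⟩ := Set.Finite.exists_le_maximal
    (Set.toFinite {A : Set V | Cov G A ∧ {w | w ∈ P.support} ⊆ A}) ⟨h0, subset_rfl⟩
  have hcov : Cov G A := hmax.prop.1
  refine ⟨A, hcov, hPA, ?_⟩
  by_contra hcon
  push Not at hcon
  -- closest pair
  have key : ∀ n, ∀ a w, a ∈ A → Big G w → w ∉ A → G.dist a w = n → False := by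
    intro n
    induction n using Nat.strong_induction_on with
    | _ n ih =>
      intro a w ha hw hwA hd
      obtain ⟨q, hq⟩ := hG.exists_walk_length_eq_dist a w
      cases q with
      | nil => exact hwA ha
      | cons h q =>
        rename_i x
        rw [Walk.length_cons] at hq
        have hxw : G.dist x w ≤ q.length := dist_le q
        have hxA : x ∉ A := fun hxA => ih _ (by omega) x w hxA hw hwA rfl
        have hxb : ¬ Big G x := by
          intro hb
          have := cov_insert hcov ha hxA h hb
          have h2 := hmax.le_of_ge (y := insert x A)
            ⟨this, fun z hz => Or.inr (hPA hz)⟩ (Set.subset_insert x A)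
          exact hxA (h2 (Set.mem_insert x A))
        cases q with
        | nil => exact hxb hw
        | cons h' q' =>
          rename_i x'
          rw [Walk.length_cons] at hq
          have hax' : ∀ r : G.Walk a x', 2 ≤ r.length := by
            intro r
            have := dist_le (r.append q')
            rw [Walk.length_append] at this
            omega
          have hne : a ≠ x' := by
            rintro rfl
            have := hax' Walk.nil
            simp at this
          have hna : ¬ G.Adj a x' := by
            intro hadj
            have := hax' hadj.toWalk
            simp at this
          refine hbad (fun i => if i = 0 then a else if i = 1 then x else x') ⟨?_, ?_⟩
          · intro i hi
            interval_cases i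
            · simpa using h
            · simpa using h'
          · intro i hi
            interval_cases i
            refine ⟨by simpa using hne, by simpa using hna, ?_, ?_⟩
            · simp only [Nat.zero_add, Nat.one_ne_zero, if_false, if_true]
              exact fun hx => hxA (hPA hx)
            · simp only [Nat.zero_add, Nat.one_ne_zero, if_false, if_true]
              intro z hz
              by_contra hz2
              push Not at hz2
              exact hxb ⟨a, x', z, hne, fun h => hz2.1 h.symm, fun h => hz2.2 (by simpa using h.symm),
                h.symm, h', hz⟩
  obtain ⟨w, hw, hwA⟩ := hcon
  exact key _ u w (hPA P.start_mem_support) hw hwA rfl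

theorem traceable_of_no_edge {V : Type*} {G : SimpleGraph V} (hG : G.Connected)
    (h : ¬ Nonempty G.edgeSet) : Traceable G := by
  obtain ⟨v⟩ := hG.nonempty
  refine ⟨v, v, Walk.nil, by simp, ?_⟩
  intro w
  obtain ⟨p⟩ := hG.preconnected v w
  cases p with
  | nil => simp
  | cons h' p => exact absurd ⟨⟨s(_, _), h'⟩⟩ h

theorem exists_edge_at {V : Type*} {G : SimpleGraph V} (hG : G.Connected)
    (e : G.edgeSet) (u : V) : ∃ e : G.edgeSet, u ∈ e.1 := by
  obtain ⟨e, he⟩ := e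
  induction e with
  | h a b =>
    obtain ⟨p⟩ := hG.preconnected u a
    cases p with
    | nil => exact ⟨⟨s(u, b), he⟩, by simp⟩
    | cons h p => exact ⟨⟨s(u, _), h⟩, by simp⟩

/-- Base case: no bad vertex. -/
theorem base_case {V : Type} [Finite V] {G : SimpleGraph V} (hG : G.Connected) {u v : V}
    (P : G.Walk u v) (hP : P.IsTrail)
    (hbad : ∀ x, ¬ BadRun G {w | w ∈ P.support} 1 x) :
    ∃ n ≤ 2, Traceable (iterLine ⟨V, G⟩ n).2 := by
  by_cases hE : Nonempty G.edgeSet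
  swap
  · exact ⟨0, by omega, traceable_of_no_edge hG hE⟩
  obtain ⟨e0⟩ := hE
  have hL := line_connected hG e0
  by_cases hE2 : Nonempty G.lineGraph.edgeSet
  swap
  · exact ⟨1, by omega, traceable_of_no_edge hL hE2⟩
  obtain ⟨g0⟩ := hE2
  refine ⟨2, le_rfl, ?_⟩
  change Traceable G.lineGraph.lineGraph
  obtain ⟨e1, he1⟩ := exists_edge_at hG e0 u
  obtain ⟨A, ⟨a, b, T, hT, hcov, -⟩, hPA, hBA⟩ :=
    cov_all hG P hP ⟨e1, u, P.start_mem_support, he1⟩ hbad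
  have hdom : ∀ g : G.lineGraph.edgeSet, ∃ e ∈ T.support, e ∈ g.1 := by
    rintro ⟨g, hg⟩
    induction g with
    | h e f =>
      by_contra hcon
      push Not at hcon
      have hadj : G.lineGraph.Adj e f := hg
      obtain ⟨hne, v, hve, hvf⟩ := lineGraph_adj_iff_exists.1 hadj
      have heA : ∀ z ∈ A, z ∉ e.1 := fun z hz hze => hcon e (hcov e ⟨z, hz, hze⟩) (by simp)
      have hfA : ∀ z ∈ A, z ∉ f.1 := fun z hz hze => hcon f (hcov f ⟨z, hz, hze⟩) (by simp)
      obtain ⟨x, hx⟩ := Sym2.mem_iff_exists.1 hve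
      obtain ⟨y, hy⟩ := Sym2.mem_iff_exists.1 hvf
      have hvx : G.Adj v x := by have := e.2; rw [hx] at this; exact this
      have hvy : G.Adj v y := by have := f.2; rw [hy] at this; exact this
      have hxy : x ≠ y := by
        rintro rfl
        exact hne (Subtype.ext (hx.trans hy.symm))
      have hvA : v ∉ A := fun h => heA v h hve
      have hxA : x ∉ A := fun h => heA x h (by rw [hx]; simp)
      have hyA : y ∉ A := fun h => hfA y h (by rw [hy]; simp)
      have nb : ∀ z p q, z ∉ A → G.Adj z p → G.Adj z q → p ≠ q →
          ∀ w, G.Adj z w → w = p ∨ w = q := by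
        intro z p q hz hp hq hpq w hw
        by_contra hc
        push Not at hc
        exact hz (hBA z ⟨p, q, w, hpq, hc.1.symm, hc.2.symm, hp, hq, hw⟩)
      have hxy' : G.Adj x y := by
        by_contra hnxy
        refine hbad (fun i => if i = 0 then x else if i = 1 then v else y) ⟨?_, ?_⟩
        · intro i hi
          interval_cases i
          · simpa using hvx.symm
          · simpa using hvy
        · intro i hi
          interval_cases i
          refine ⟨by simpa using hxy, by simpa using hnxy, ?_, ?_⟩
          · simp only [Nat.zero_add, Nat.one_ne_zero, if_false, if_true]
            exact fun h => hvA (hPA v h)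
          · simp only [Nat.zero_add, Nat.one_ne_zero, if_false, if_true]
            intro z hz
            simpa using nb v x y hvA hvx hvy hxy z hz
      -- the triangle is closed under adjacency
      have hclosed : ∀ {p q : V} (r : G.Walk p q), (p = v ∨ p = x ∨ p = y) →
          (q = v ∨ q = x ∨ q = y) := by
        intro p q r
        induction r with
        | nil => exact id
        | cons h r ih =>
          intro hp
          apply ih
          rcases hp with rfl | rfl | rfl
          · rcases nb _ x y hvA hvx hvy hxy _ h with h | h <;> simp [h]
          · rcases nb _ v y hxA hvx.symm hxy' hvy.ne _ h with h | h <;> simp [h]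
          · rcases nb _ v x hyA hvy.symm hxy'.symm hvx.ne _ h with h | h <;> simp [h]
      obtain ⟨r⟩ := hG.preconnected v u
      have huA : u ∈ A := hPA u P.start_mem_support
      rcases hclosed r (Or.inl rfl) with h | h | h <;> subst h
      exacts [hvA huA, hxA huA, hyA huA]
  obtain ⟨c, d, p, hp, hp1, -⟩ := line_path G.lineGraph T hT ⟨g0, hdom g0⟩
  exact ⟨c, d, p, hp, fun w => hp1 w (hdom w)⟩

/-- If bad runs off a trail have at most `m` vertices then `L^(m+2)` (or earlier) is traceable. -/
theorem main_induction_s14 (m : ℕ) : ∀ {V : Type} [Finite V] {G : SimpleGraph V}, G.Connected →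
    ∀ {u v : V} (P : G.Walk u v), P.IsTrail →
    (∀ x, ¬ BadRun G {w | w ∈ P.support} (m + 1) x) →
    ∃ n ≤ m + 2, Traceable (iterLine ⟨V, G⟩ n).2 := by
  induction m with
  | zero =>
    intro V _ G hG u v P hP hbad
    exact base_case hG P hP hbad
  | succ m ih =>
    intro V _ G hG u v P hP hbad
    by_cases hE : Nonempty G.edgeSet
    swap
    · exact ⟨0, by omega, traceable_of_no_edge hG hE⟩
    obtain ⟨e0⟩ := hE
    obtain ⟨e1, he1⟩ := exists_edge_at hG e0 u
    obtain ⟨e, f, p, hp, hp1, -⟩ := line_path G P hP ⟨e1, u, P.start_mem_support, he1⟩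
    obtain ⟨n, hn, ht⟩ := ih (line_connected hG e0) p hp.isTrail (by
      intro x hx
      obtain ⟨y, hy⟩ := badRun_line (S := {w | w ∈ P.support}) hp1 (by omega) hx
      exact hbad y hy)
    exact ⟨n + 1, by omega, ht⟩
theorem badRun_ne {V : Type*} {G : SimpleGraph V} (hG : G.Connected) {S : Set V} {w : V}
    (hw : w ∈ S) {s : ℕ} {x : ℕ → V} (hx : BadRun G S s x) :
    ∀ d i, i + d + 1 < s → x (i + 1) = x (i + d + 2) → False := by
  obtain ⟨ha, hb⟩ := hx
  intro d
  induction d using Nat.strong_induction_on with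
  | _ d ih =>
    intro i hi h
    match d, ih, hi, h with
    | 0, _, hi, h => exact (ha (i + 1) (by omega)).ne h
    | 1, _, hi, h => exact (hb (i + 1) (by omega)).1 h
    | d + 2, ih, hi, h =>
      have hadj : G.Adj (x (i + 1)) (x (i + d + 3)) := by
        rw [h]; exact (ha (i + d + 3) (by omega)).symm
      rcases (hb i (by omega)).2.2.2 _ hadj with h' | h'
      · have hclosed : ∀ {p q : V} (r : G.Walk p q), (∃ k, k ≤ d + 2 ∧ p = x (i + k + 1)) →
            ∃ k, k ≤ d + 2 ∧ q = x (i + k + 1) := by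
          intro p q r
          induction r with
          | nil => exact id
          | cons hh r ih2 =>
            rintro ⟨k, hk, rfl⟩
            apply ih2
            rcases (hb (i + k) (by omega)).2.2.2 _ hh with h1 | h1
            · rcases Nat.eq_zero_or_pos k with rfl | hk0
              · exact ⟨d + 2, le_rfl, by rw [h1]; exact h'.symm⟩
              · exact ⟨k - 1, by omega, by rw [h1]; congr 1; omega⟩
            · by_cases hk2 : k = d + 2
              · subst hk2
                exact ⟨0, by omega, by rw [h1]; exact h.symm⟩
              · exact ⟨k + 1, by omega, h1⟩
        obtain ⟨r⟩ := hG.preconnected (x (i + 1)) w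
        obtain ⟨k, hk, hwk⟩ := hclosed r ⟨0, by omega, rfl⟩
        exact (hb (i + k) (by omega)).2.2.1 (hwk ▸ hw)
      · exact ih d (by omega) (i + 1) (by omega)
          (by rw [show i + 1 + d + 2 = i + d + 3 by omega]; exact h'.symm)

theorem badRun_inj {V : Type*} {G : SimpleGraph V} (hG : G.Connected) {S : Set V} {w : V}
    (hw : w ∈ S) {s : ℕ} {x : ℕ → V} (hx : BadRun G S s x) {i j : ℕ} (hi : i < s) (hj : j < s)
    (h : x (i + 1) = x (j + 1)) : i = j := by
  by_contra hne
  rcases Nat.lt_or_gt_of_ne hne with hlt | hlt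
  · exact badRun_ne hG hw hx (j - i - 1) i (by omega)
      (by rw [show i + (j - i - 1) + 2 = j + 1 by omega]; exact h)
  · exact badRun_ne hG hw hx (i - j - 1) j (by omega)
      (by rw [show j + (i - j - 1) + 2 = i + 1 by omega]; exact h.symm)

theorem badRun_reverse {V : Type*} {G : SimpleGraph V} {S : Set V}
    {s : ℕ} {x : ℕ → V} (hx : BadRun G S s x) : BadRun G S s (fun i => x (s + 1 - i)) := by
  obtain ⟨ha, hb⟩ := hx
  constructor
  · intro i hi
    have := ha (s - i) (by omega)
    rw [show s - i + 1 = s + 1 - i by omega] at this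
    simpa [show s + 1 - (i + 1) = s - i by omega] using this.symm
  · intro i hi
    have h := hb (s - 1 - i) (by omega)
    rw [show s - 1 - i + 2 = s + 1 - i by omega, show s - 1 - i + 1 = s - i by omega] at h
    simp only [show s + 1 - (i + 2) = s - 1 - i by omega, show s + 1 - (i + 1) = s - i by omega]
    exact ⟨h.1.symm, fun h' => h.2.1 h'.symm, h.2.2.1, fun u hu => (h.2.2.2 u hu).symm⟩

theorem badRun_path {V : Type*} {G : SimpleGraph V} (hG : G.Connected) {S : Set V} {w : V}
    (hw : w ∈ S) {s : ℕ} {x : ℕ → V} (hx : BadRun G S s x) :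
    ∀ k, k < s → ∃ q : G.Walk (x 1) (x (k + 1)), q.IsPath ∧
      ∀ z, z ∈ q.support ↔ ∃ i ≤ k, z = x (i + 1) := by
  intro k
  induction k with
  | zero =>
    intro _
    refine ⟨Walk.nil, by simp, ?_⟩
    intro z
    simp
  | succ k ih =>
    intro hk
    obtain ⟨q, hq, hs⟩ := ih (by omega)
    refine ⟨q.concat (hx.1 (k + 1) (by omega)), hq.concat ?_ _, ?_⟩
    · rw [hs]
      rintro ⟨i, hi, h⟩
      have := badRun_inj hG hw hx (i := k + 1) (j := i) hk (by omega) h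
      omega
    · intro z
      rw [Walk.support_concat]
      simp only [List.mem_append, List.mem_singleton, hs]
      constructor
      · rintro (⟨i, hi, h⟩ | h)
        · exact ⟨i, by omega, h⟩
        · exact ⟨k + 1, le_rfl, h⟩
      · rintro ⟨i, hi, h⟩
        by_cases hik : i = k + 1
        · subst hik; exact Or.inr h
        · exact Or.inl ⟨i, by omega, h⟩

open Classical in
theorem badRun_connect {V : Type*} {G : SimpleGraph V} (hG : G.Connected) {S : Set V} {w : V}
    (hw : w ∈ S) {s : ℕ} (hs : 1 ≤ s) {x : ℕ → V} (hx : BadRun G S s x) :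
    ∃ x', BadRun G S s x' ∧ ∃ p ∈ S, ∃ R : G.Walk p (x' 0), R.IsPath ∧
      (∀ z ∈ R.support, z ∈ S → z = p) ∧ ∀ z ∈ R.support, ∀ i < s, z ≠ x' (i + 1) := by
  have hex : ∃ n, ∃ p ∈ S, ∃ k < s, ∃ R : G.Walk p (x (k + 1)), R.length = n := by
    obtain ⟨r⟩ := hG.preconnected w (x 1)
    exact ⟨_, w, hw, 0, by omega, r, rfl⟩
  obtain ⟨p, hp, k, hk, R, hR⟩ := Nat.find_spec hex
  have hmin : ∀ p' ∈ S, ∀ k' < s, ∀ R' : G.Walk p' (x (k' + 1)), R.length ≤ R'.length := by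
    intro p' hp' k' hk' R'
    rw [hR]
    exact Nat.find_min' hex ⟨p', hp', k', hk', R', rfl⟩
  have hgen : ∀ (r : V) (R' : G.Walk p r) (h : G.Adj r (x (k + 1))),
      R'.length + 1 ≤ R.length →
      ∃ R'' : G.Walk p r, R''.IsPath ∧
      (∀ z ∈ R''.support, z ∈ S → z = p) ∧ ∀ z ∈ R''.support, ∀ i < s, z ≠ x (i + 1) := by
    intro r R' h hlen
    have hb := Walk.length_bypass_le R'
    refine ⟨R'.bypass, R'.bypass_isPath, ?_, ?_⟩
    · intro z hz hzS
      by_contra hzp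
      have h1 := hmin z hzS k hk ((R'.bypass.dropUntil z hz).concat h)
      rw [Walk.length_concat] at h1
      have h2 := congrArg Walk.length (R'.bypass.take_spec hz)
      rw [Walk.length_append] at h2
      have h3 : (R'.bypass.takeUntil z hz).length = 0 := by omega
      exact hzp (Walk.eq_of_length_eq_zero h3).symm
    · rintro z hz i hi rfl
      have h1 := hmin p hp i hi (R'.bypass.takeUntil _ hz)
      have h2 := Walk.length_takeUntil_le_length R'.bypass hz
      omega
  have hpne : p ≠ x (k + 1) := by
    rintro rfl
    exact (hx.2 k hk).2.2.1 hp
  obtain ⟨r, R', h, hRc⟩ : ∃ (r : V) (R' : G.Walk p r) (h : G.Adj r (x (k + 1))),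
      R'.length + 1 ≤ R.length := by
    refine ⟨_, R.dropLast, R.adj_penultimate (Walk.not_nil_of_ne hpne), ?_⟩
    have : R.length ≠ 0 := fun h0 => hpne (Walk.eq_of_length_eq_zero h0)
    have h2 := congrArg Walk.length (R.concat_dropLast (R.adj_penultimate (Walk.not_nil_of_ne hpne)))
    rw [Walk.length_concat] at h2
    omega
  obtain ⟨R'', h1, h2, h3⟩ := hgen r R' h hRc
  rcases (hx.2 k hk).2.2.2 r h.symm with hr | hr
  · have hk0 : k = 0 := by
      by_contra hk0
      exact h3 r R''.end_mem_support (k - 1) (by omega)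
        (by rw [hr]; congr 1; omega)
    subst hk0
    subst hr
    exact ⟨x, hx, p, hp, R'', h1, h2, h3⟩
  · have hk0 : k + 1 = s := by
      by_contra hk0
      exact h3 r R''.end_mem_support (k + 1) (by omega) hr
    subst hk0
    subst hr
    refine ⟨_, badRun_reverse hx, p, hp, R'', h1, h2, ?_⟩
    intro z hz i hi
    have := h3 z hz (k - i) (by omega)
    simpa only [show k + 1 + 1 - (i + 1) = k - i + 1 by omega] using this

open Classical in
theorem three_mul_le {V : Type*} [Fintype V] {G : SimpleGraph V} (N : Finset V) {a b : V}
    (P : G.Walk a b) (hP : P.IsTrail)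
    (hmax : ∀ (c d : V) (T : G.Walk c d), T.IsTrail →
      (T.support.toFinset \ N).card ≤ (P.support.toFinset \ N).card)
    {p q : V} (hp : p ∈ P.support) (Q : G.Walk p q) (hQ : Q.IsTrail)
    (hQP : ∀ z ∈ Q.support, z ∈ P.support → z = p) :
    3 * ((Q.support.toFinset.erase p) \ N).card + N.card ≤ Fintype.card V := by
  set D := (Q.support.toFinset.erase p) \ N with hD
  set A := P.takeUntil p hp with hA
  set B := P.dropUntil p hp with hB
  have hAt : A.IsTrail := hP.takeUntil hp
  have hBt : B.IsTrail := hP.dropUntil hp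
  have hs : ∀ z, z ∈ P.support ↔ z ∈ A.support ∨ z ∈ B.support := by
    intro z; rw [← Walk.mem_support_append_iff, hA, hB, P.take_spec hp]
  have hdisj : ∀ {c d : V} (W : G.Walk c d), (∀ z ∈ W.support, z ∈ P.support) →
      W.edges.Disjoint Q.edges := by
    intro c d W hW e
    induction e with
    | h y z =>
      intro h1 h2
      have hy := hQP y (Q.fst_mem_support_of_mem_edges h2) (hW y (W.fst_mem_support_of_mem_edges h1))
      have hz := hQP z (Q.snd_mem_support_of_mem_edges h2) (hW z (W.snd_mem_support_of_mem_edges h1))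
      exact (Q.adj_of_mem_edges h2).ne (hy.trans hz.symm)
  have hDP : ∀ z ∈ D, z ∉ P.support := by
    intro z hz hzP
    simp only [hD, Finset.mem_sdiff, Finset.mem_erase, List.mem_toFinset] at hz
    exact hz.1.1 (hQP z hz.1.2 hzP)
  have gen : ∀ {c : V} (W : G.Walk c p), W.IsTrail → (∀ z ∈ W.support, z ∈ P.support) →
      (W.support.toFinset \ N).card + D.card ≤ (P.support.toFinset \ N).card := by
    intro c W hW hWP
    have h1 := hmax _ _ (W.append Q) (by
      rw [Walk.isTrail_append]
      exact ⟨hW, hQ, hdisj W hWP⟩)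
    refine le_trans ?_ h1
    rw [← Finset.card_union_of_disjoint]
    · apply Finset.card_le_card
      intro z hz
      simp only [hD, Finset.mem_union, Finset.mem_sdiff, Finset.mem_erase, List.mem_toFinset,
        Walk.mem_support_append_iff] at hz ⊢
      tauto
    · rw [Finset.disjoint_left]
      intro z hz hz2
      simp only [Finset.mem_sdiff, List.mem_toFinset] at hz
      exact hDP z hz2 (hWP z hz.1)
  have gA := gen A hAt (fun z hz => (hs z).2 (Or.inl hz))
  have gB := gen B.reverse hBt.reverse (fun z hz => (hs z).2 (Or.inr (by simpa using hz)))
  have hBr : B.reverse.support.toFinset = B.support.toFinset := by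
    ext z; simp
  rw [hBr] at gB
  have hU : (P.support.toFinset \ N).card ≤
      (A.support.toFinset \ N).card + (B.support.toFinset \ N).card := by
    refine le_trans (Finset.card_le_card ?_) (Finset.card_union_le _ _)
    intro z hz
    simp only [Finset.mem_union, Finset.mem_sdiff, List.mem_toFinset, hs] at hz ⊢
    tauto
  have hV : (P.support.toFinset \ N).card + D.card + N.card ≤ Fintype.card V := by
    rw [← Finset.card_union_of_disjoint, ← Finset.card_union_of_disjoint]
    · exact Finset.card_le_univ _
    · rw [Finset.disjoint_left]
      intro z hz
      simp only [hD, Finset.mem_union, Finset.mem_sdiff] at hz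
      tauto
    · rw [Finset.disjoint_left]
      intro z hz hz2
      simp only [Finset.mem_sdiff, List.mem_toFinset] at hz
      exact hDP z hz2 hz.1
  omega

open Classical in
theorem exists_max_trail {V : Type*} [Fintype V] [Nonempty V] (G : SimpleGraph V)
    (N : Finset V) : ∃ (a b : V) (P : G.Walk a b), P.IsTrail ∧
      ∀ (c d : V) (T : G.Walk c d), T.IsTrail →
      (T.support.toFinset \ N).card ≤ (P.support.toFinset \ N).card := by
  set K : Set ℕ := {k | ∃ (a b : V) (P : G.Walk a b), P.IsTrail ∧
    (P.support.toFinset \ N).card = k} with hK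
  have hne : K.Nonempty := by
    obtain ⟨v⟩ := ‹Nonempty V›
    exact ⟨_, v, v, Walk.nil, by simp, rfl⟩
  have hbd : BddAbove K := by
    refine ⟨Fintype.card V, ?_⟩
    rintro k ⟨a, b, P, -, rfl⟩
    exact Finset.card_le_univ _
  obtain ⟨a, b, P, hP, h⟩ := Nat.sSup_mem hne hbd
  refine ⟨a, b, P, hP, ?_⟩
  intro c d T hT
  rw [h]
  exact le_csSup hbd ⟨c, d, T, hT, rfl⟩

open Classical in
/-- The combinatorial core: off a suitable trail, bad runs are short. -/
theorem exists_good_trail {V : Type*} [Fintype V] (G : SimpleGraph V) (hG : G.Connected)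
    (Δ : ℕ) (v : V) (N0 : Finset V) (hN0 : ∀ z, z ∈ N0 ↔ G.Adj v z) (hΔ : N0.card = Δ) :
    ∃ (a b : V) (P : G.Walk a b), P.IsTrail ∧
      ∀ x, ¬ BadRun G {w | w ∈ P.support} ((Fintype.card V - Δ) / 3 + 2) x := by
  have hnev : Nonempty V := ⟨v⟩
  set s := (Fintype.card V - Δ) / 3 + 2 with hs
  have h3s : Fintype.card V - Δ + 3 < 3 * s := by omega
  set N : Finset V := if 3 ≤ Δ then N0 else ∅ with hN
  obtain ⟨a, b, P, hP, hmax⟩ := exists_max_trail G N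
  refine ⟨a, b, P, hP, ?_⟩
  intro x0 hx0
  obtain ⟨x, hx, p, hp, R, hR, hRP, hRX⟩ :=
    badRun_connect hG (w := a) P.start_mem_support (by omega) hx0
  have hinj : ∀ {i j : ℕ}, i < s → j < s → x (i + 1) = x (j + 1) → i = j :=
    fun hi hj h => badRun_inj hG (w := a) P.start_mem_support hx hi hj h
  obtain ⟨W, hW, hWs⟩ := badRun_path hG (w := a) P.start_mem_support hx (s - 1) (by omega)
  have h01 : G.Adj (x 0) (x 1) := hx.1 0 (by omega)
  have hx0W : x 0 ∉ W.support := by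
    rw [hWs]
    rintro ⟨i, hi, h⟩
    exact hRX _ R.end_mem_support i (by omega) h
  set Q := R.append (Walk.cons h01 W) with hQ
  have hQs : ∀ z, z ∈ Q.support ↔ z ∈ R.support ∨ ∃ i < s, z = x (i + 1) := by
    intro z
    rw [hQ, Walk.mem_support_append_iff, Walk.support_cons, List.mem_cons, hWs]
    constructor
    · rintro (h | rfl | ⟨i, hi, h⟩)
      · exact Or.inl h
      · exact Or.inl R.end_mem_support
      · exact Or.inr ⟨i, by omega, h⟩
    · rintro (h | ⟨i, hi, h⟩)
      · exact Or.inl h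
      · exact Or.inr (Or.inr ⟨i, by omega, h⟩)
  have hQt : Q.IsTrail := by
    rw [hQ, Walk.isTrail_append]
    refine ⟨hR.isTrail, (hW.cons hx0W).isTrail, ?_⟩
    intro e
    induction e with
    | h y z =>
      intro h1 h2
      have hy := R.fst_mem_support_of_mem_edges h1
      have hz := R.snd_mem_support_of_mem_edges h1
      have hne := (R.adj_of_mem_edges h1).ne
      have hy2 := Walk.fst_mem_support_of_mem_edges _ h2
      have hz2 := Walk.snd_mem_support_of_mem_edges _ h2
      rw [Walk.support_cons, List.mem_cons, hWs] at hy2 hz2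
      rcases hy2 with hy2 | ⟨i, hi, hy2⟩
      · rcases hz2 with hz2 | ⟨i, hi, hz2⟩
        · exact hne (hy2.trans hz2.symm)
        · exact hRX z hz i (by omega) hz2
      · exact hRX y hy i (by omega) hy2
  have hXP : ∀ i < s, x (i + 1) ∉ P.support := fun i hi => (hx.2 i hi).2.2.1
  have hthree := three_mul_le N P hP hmax hp Q hQt (by
    intro z hz hzP
    rcases (hQs z).1 hz with h | ⟨i, hi, rfl⟩
    · exact hRP z h hzP
    · exact absurd hzP (hXP i hi))
  have hDmem : ∀ z, z ∈ (Q.support.toFinset.erase p) \ N ↔ (z ≠ p ∧ z ∈ Q.support) ∧ z ∉ N := by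
    intro z; simp
  have hXD : ∀ i < s, x (i + 1) ∉ N → x (i + 1) ∈ (Q.support.toFinset.erase p) \ N := by
    intro i hi h
    rw [hDmem]
    refine ⟨⟨?_, (hQs _).2 (Or.inr ⟨i, hi, rfl⟩)⟩, h⟩
    rintro rfl
    exact hXP i hi hp
  have hcard : ∀ I : Finset ℕ, (∀ i ∈ I, i < s) →
      (I.image (fun i => x (i + 1))).card = I.card := by
    intro I hI
    apply Finset.card_image_of_injOn
    intro i hi j hj h
    exact hinj (hI i hi) (hI j hj) h
  have hsub : ∀ I : Finset ℕ, (∀ i ∈ I, i < s ∧ x (i + 1) ∉ N) →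
      I.card ≤ ((Q.support.toFinset.erase p) \ N).card := by
    intro I hI
    rw [← hcard I (fun i hi => (hI i hi).1)]
    apply Finset.card_le_card
    intro z hz
    obtain ⟨i, hi, rfl⟩ := Finset.mem_image.1 hz
    exact hXD i (hI i hi).1 (hI i hi).2
  by_cases hΔ3 : 3 ≤ Δ
  swap
  · have hN' : N = ∅ := by rw [hN, if_neg hΔ3]
    have := hsub (Finset.range s) (by
      intro i hi; rw [hN']; exact ⟨Finset.mem_range.1 hi, by simp⟩)
    rw [Finset.card_range] at this
    omega
  have hN' : N = N0 := by rw [hN, if_pos hΔ3]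
  have hNmem : ∀ z, z ∈ N ↔ G.Adj v z := by rw [hN']; exact hN0
  have hNc : N.card = Δ := by rw [hN']; exact hΔ
  suffices hsuff : s - 1 ≤ ((Q.support.toFinset.erase p) \ N).card by omega
  have hvX : ∀ i < s, v ≠ x (i + 1) := by
    rintro i hi rfl
    have : N0 ⊆ {x i, x (i + 2)} := by
      intro z hz
      have := (hx.2 i hi).2.2.2 z ((hN0 z).1 hz)
      simpa using this
    have h2 := Finset.card_le_card this
    have h3 : ({x i, x (i + 2)} : Finset V).card ≤ 2 := Finset.card_le_two
    omega
  have hmid : ∀ i, 0 < i → i + 1 < s → x (i + 1) ∉ N := by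
    intro i h0 h1 h
    rw [hNmem] at h
    rcases (hx.2 i (by omega)).2.2.2 v h.symm with h' | h'
    · exact hvX (i - 1) (by omega) (by rw [h']; congr 1; omega)
    · exact hvX (i + 1) (by omega) h'
  by_cases hfirst : x (0 + 1) ∈ N
  swap
  · have := hsub ((Finset.range s).erase (s - 1)) (by
      intro i hi
      rw [Finset.mem_erase, Finset.mem_range] at hi
      refine ⟨hi.2, ?_⟩
      rcases Nat.eq_zero_or_pos i with rfl | h0
      · exact hfirst
      · exact hmid i h0 (by omega))
    rwa [Finset.card_erase_of_mem (Finset.mem_range.2 (by omega)), Finset.card_range] at this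
  by_cases hlast : x (s - 1 + 1) ∈ N
  swap
  · have := hsub ((Finset.range s).erase 0) (by
      intro i hi
      rw [Finset.mem_erase, Finset.mem_range] at hi
      refine ⟨hi.2, ?_⟩
      by_cases h0 : i = s - 1
      · rw [h0]; exact hlast
      · exact hmid i (by omega) (by omega))
    rwa [Finset.card_erase_of_mem (Finset.mem_range.2 (by omega)), Finset.card_range] at this
  rw [hNmem] at hfirst hlast
  have hv0 : v = x 0 := by
    rcases (hx.2 0 (by omega)).2.2.2 v hfirst.symm with h | h
    · exact h
    · exact absurd h (hvX 1 (by omega))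
  by_cases hvP : v ∈ P.support
  · -- splice a loop at `v`
    exfalso
    have hs3 : 3 ≤ s := by
      by_contra hlt
      have h2 : s = 2 := by omega
      rw [h2] at hlast
      exact (hx.2 0 (by omega)).2.1 (hv0 ▸ hlast)
    have hvW : v ∉ W.support := by rw [hv0]; exact hx0W
    have hne : x 1 ≠ x (s - 1 + 1) := by
      intro h
      have := hinj (i := 0) (j := s - 1) (by omega) (by omega) h
      omega
    have hloop := loop_trail W hW hne hvW hfirst hlast.symm
    set C := Walk.cons hfirst (W.concat hlast.symm) with hC
    have hCs : ∀ z, z ∈ C.support → z = v ∨ ∃ i ≤ s - 1, z = x (i + 1) := by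
      intro z hz
      rw [hC, Walk.support_cons, Walk.support_concat] at hz
      simp only [List.mem_cons, List.mem_append, hWs, List.not_mem_nil, or_false] at hz
      tauto
    obtain ⟨T, hT, hTs, -⟩ := splice P hP hvP C hloop (by
      intro e
      induction e with
      | h y z =>
        intro h1 h2
        have hy := P.fst_mem_support_of_mem_edges h2
        have hz := P.snd_mem_support_of_mem_edges h2
        rcases hCs y (C.fst_mem_support_of_mem_edges h1) with hy' | ⟨i, hi, rfl⟩
        · rcases hCs z (C.snd_mem_support_of_mem_edges h1) with hz' | ⟨i, hi, rfl⟩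
          · exact (P.adj_of_mem_edges h2).ne (hy'.trans hz'.symm)
          · exact hXP i (by omega) hz
        · exact hXP i (by omega) hy)
    have hlt : (P.support.toFinset \ N).card < (T.support.toFinset \ N).card := by
      apply Finset.card_lt_card
      rw [Finset.ssubset_iff_of_subset]
      · refine ⟨x (1 + 1), ?_, ?_⟩
        · simp only [Finset.mem_sdiff, List.mem_toFinset, hTs]
          refine ⟨Or.inr ?_, hmid 1 (by omega) (by omega)⟩
          rw [hC, Walk.support_cons, Walk.support_concat]
          simp only [List.mem_cons, List.mem_append, hWs]
          exact Or.inr (Or.inl ⟨1, by omega, rfl⟩)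
        · simp only [Finset.mem_sdiff, List.mem_toFinset]
          exact fun h => hXP 1 (by omega) h.1
      · intro z hz
        simp only [Finset.mem_sdiff, List.mem_toFinset, hTs] at hz ⊢
        tauto
    exact absurd (hmax _ _ T hT) (by omega)
  · -- `v` itself contributes
    set I := ((Finset.range s).erase 0).erase (s - 1) with hI
    have hIm : ∀ i ∈ I, 0 < i ∧ i + 1 < s := by
      intro i hi
      rw [hI, Finset.mem_erase, Finset.mem_erase, Finset.mem_range] at hi
      omega
    have hIc : I.card = s - 2 := by
      rw [hI, Finset.card_erase_of_mem, Finset.card_erase_of_mem, Finset.card_range]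
      · omega
      · exact Finset.mem_range.2 (by omega)
      · rw [Finset.mem_erase, Finset.mem_range]; omega
    have hvI : v ∉ I.image (fun i => x (i + 1)) := by
      intro h
      obtain ⟨i, hi, h⟩ := Finset.mem_image.1 h
      exact hvX i (by have := hIm i hi; omega) h.symm
    have h1 : (insert v (I.image (fun i => x (i + 1)))).card = s - 1 := by
      rw [Finset.card_insert_of_notMem hvI, hcard I (fun i hi => by have := hIm i hi; omega), hIc]
      omega
    refine h1.symm.le.trans (Finset.card_le_card ?_)
    intro z hz
    rcases Finset.mem_insert.1 hz with rfl | hz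
    · rw [hDmem]
      refine ⟨⟨?_, (hQs _).2 (Or.inl ?_)⟩, ?_⟩
      · rintro rfl; exact hvP hp
      · rw [hv0]; exact R.end_mem_support
      · rw [hNmem]; exact G.irrefl
    · obtain ⟨i, hi, rfl⟩ := Finset.mem_image.1 hz
      have := hIm i hi
      exact hXD i (by omega) (hmid i this.1 this.2)

/-- `h_p(G) ≤ ⌊(n - Δ(G))/3⌋ + 3` for a connected simple graph of order `n`. -/
theorem stmt14 {V : Type} [Fintype V] [DecidableEq V] (G : SimpleGraph V)
    [DecidableRel G.Adj] (hG : G.Connected) :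
    hp G ≤ (Fintype.card V - G.maxDegree) / 3 + 3 := by
  have hne : Nonempty V := hG.nonempty
  obtain ⟨v, hv⟩ := G.exists_maximal_degree_vertex
  obtain ⟨a, b, P, hP, hbad⟩ := exists_good_trail G hG G.maxDegree v (G.neighborFinset v)
    (fun z => G.mem_neighborFinset v z) hv.symm
  obtain ⟨n, hn, ht⟩ := main_induction_s14 ((Fintype.card V - G.maxDegree) / 3 + 1) hG P hP hbad
  exact (Nat.sInf_le ht).trans hn
end Paper
end
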